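/- Let α ∈ ℝ with αχ ≤ 0 and suppose ū ∈ U^E has constant combinatorial α-curvature (R_{α,i}(ū) independent of i). Then there exists δ > 0 with the following property: every solution of the combinatorial α-Calabi flow du_i/dt = (Δ_α R_α)_i with initial value u(0) ∈ U^E satisfying ‖R_α(u(0)) − R_α(ū)‖ < δ and Σ_i e^{α u_i(0)} = Σ_i e^{α ū_i} (when α ≠ 0), respectively ‖u(0) − ū‖ < δ and Σ_i u_i(0) = Σ_i ū_i (when α = 0), exists for all time t ∈ [0,∞) and converges exponentially fast to ū, i.e. there are constants C, β > 0 with ‖u(t) − ū‖ ≤ C e^{−βt} for all t ≥ 0. The same holds for the normalized combinatorial α-Ricci flow du_i/dt = 2πχ/(Σ_j e^{α u_j}) − R_{α,i}(u). -/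

import Mathlib

open Real

/-- A combinatorial triangulation of a connected closed surface on the vertex set
`Fin N`: a nonempty set of triangular faces covering all vertices, such that every
edge (2-element subset of a face) lies in exactly two faces and the underlying
graph is connected. -/
structure TriSurface (N : ℕ) where
  /-- The set of faces, each a 3-element subset of the vertex set. -/
  F : Finset (Finset (Fin N))
  F_nonempty : F.Nonempty
  card_face : ∀ σ ∈ F, σ.card = 3
  vertex_cover : ∀ v : Fin N, ∃ σ ∈ F, v ∈ σ
  edge_two_faces : ∀ e : Finset (Fin N), e.card = 2 → (∃ σ ∈ F, e ⊆ σ) →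
    (F.filter fun σ => e ⊆ σ).card = 2
  connected : (SimpleGraph.fromRel fun i j => ∃ σ ∈ F, i ∈ σ ∧ j ∈ σ).Connected

namespace TriSurface

variable {N : ℕ}

/-- The edge set: all 2-element subsets of faces. -/
def edges (S : TriSurface N) : Finset (Finset (Fin N)) :=
  S.F.biUnion fun σ => Finset.powersetCard 2 σ

/-- The Euler characteristic `χ = N - |E| + |F|`. -/
def chi (S : TriSurface N) : ℤ :=
  (N : ℤ) - (S.edges.card : ℤ) + (S.F.card : ℤ)

/-- Weights on a triangulated surface: scheme coefficients `ε : V → {0,1}` and symmetric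
discrete conformal structure coefficients `η : E → ℝ`, subject to the structure conditions
`ε_s ε_t + η_st > 0` on every edge and `ε_q η_st + η_qs η_qt ≥ 0` in every face. -/
structure Weights (S : TriSurface N) where
  eps : Fin N → ℝ
  eta : Fin N → Fin N → ℝ
  eps01 : ∀ i, eps i = 0 ∨ eps i = 1
  eta_symm : ∀ i j, eta i j = eta j i
  structCond1 : ∀ i j : Fin N, ({i, j} : Finset (Fin N)) ∈ S.edges →
    eps i * eps j + eta i j > 0
  structCond2 : ∀ i j k : Fin N, ({i, j, k} : Finset (Fin N)) ∈ S.F →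
    i ≠ j → i ≠ k → j ≠ k → eps i * eta j k + eta i j * eta i k ≥ 0

variable {S : TriSurface N}

/-! ### Euclidean background -/

/-- Euclidean edge length `l_ij = sqrt(ε_i e^{2u_i} + ε_j e^{2u_j} + 2 η_ij e^{u_i+u_j})`. -/
noncomputable def lE (W : Weights S) (u : Fin N → ℝ) (i j : Fin N) : ℝ :=
  Real.sqrt (W.eps i * exp (2 * u i) + W.eps j * exp (2 * u j) +
    2 * W.eta i j * exp (u i + u j))

/-- The admissible space `U^E`: discrete conformal factors for which every face satisfies
the strict triangle inequalities. -/
def admissibleE (W : Weights S) (u : Fin N → ℝ) : Prop :=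
  ∀ i j k : Fin N, ({i, j, k} : Finset (Fin N)) ∈ S.F →
    lE W u i j + lE W u i k > lE W u j k

/-- The inner angle `θ_i^{jk}` at `i` in the face `{i,j,k}`, by the law of cosines. -/
noncomputable def thetaE (W : Weights S) (u : Fin N → ℝ) (i j k : Fin N) : ℝ :=
  arccos ((lE W u i j ^ 2 + lE W u i k ^ 2 - lE W u j k ^ 2) /
    (2 * lE W u i j * lE W u i k))

open Classical in
/-- The extended inner angle `θ̃_i^{jk}`: equal to `θ_i^{jk}` when the three strict triangle
inequalities hold in the face, to `π` when the edge opposite to `i` dominates, and to `0`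
otherwise. -/
noncomputable def thetaExE (W : Weights S) (u : Fin N → ℝ) (i j k : Fin N) : ℝ :=
  if lE W u i j + lE W u i k > lE W u j k ∧ lE W u i j + lE W u j k > lE W u i k ∧
      lE W u i k + lE W u j k > lE W u i j then thetaE W u i j k
  else if lE W u j k ≥ lE W u i j + lE W u i k then π else 0

open Classical in
/-- The angle at `i` in a face `σ` containing `i` (the half-sum over the two orderings of
the remaining two vertices; the angle is symmetric in the last two arguments). -/
noncomputable def faceAngleE (W : Weights S) (u : Fin N → ℝ) (i : Fin N)
    (σ : Finset (Fin N)) : ℝ :=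
  (1 / 2) * ∑ j ∈ σ.erase i, ∑ k ∈ (σ.erase i).erase j, thetaE W u i j k

open Classical in
/-- The extended angle at `i` in a face `σ` containing `i`. -/
noncomputable def faceAngleExE (W : Weights S) (u : Fin N → ℝ) (i : Fin N)
    (σ : Finset (Fin N)) : ℝ :=
  (1 / 2) * ∑ j ∈ σ.erase i, ∑ k ∈ (σ.erase i).erase j, thetaExE W u i j k

open Classical in
/-- The classical combinatorial curvature `K_i = 2π − Σ θ_i^{jk}`. -/
noncomputable def KE (W : Weights S) (u : Fin N → ℝ) (i : Fin N) : ℝ :=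
  2 * π - ∑ σ ∈ S.F.filter (fun σ => i ∈ σ), faceAngleE W u i σ

open Classical in
/-- The extended combinatorial curvature `K̃_i = 2π − Σ θ̃_i^{jk}`. -/
noncomputable def KExE (W : Weights S) (u : Fin N → ℝ) (i : Fin N) : ℝ :=
  2 * π - ∑ σ ∈ S.F.filter (fun σ => i ∈ σ), faceAngleExE W u i σ

/-- The combinatorial `α`-curvature `R_{α,i} = K_i e^{−α u_i}` (Euclidean background). -/
noncomputable def RE (W : Weights S) (α : ℝ) (u : Fin N → ℝ) (i : Fin N) : ℝ :=
  KE W u i * exp (-(α * u i))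

/-- The extended combinatorial `α`-curvature `R̃_{α,i} = K̃_i e^{−α u_i}` (Euclidean). -/
noncomputable def RExE (W : Weights S) (α : ℝ) (u : Fin N → ℝ) (i : Fin N) : ℝ :=
  KExE W u i * exp (-(α * u i))

/-- The Jacobian `∂K_i/∂u_j` of the curvature map in the Euclidean background. -/
noncomputable def DKE (W : Weights S) (u : Fin N → ℝ) (i j : Fin N) : ℝ :=
  fderiv ℝ (fun v => KE W v i) u (Pi.single j 1)

/-- The discrete `α`-Laplacian `(Δ_α g)_i = −e^{−α u_i} Σ_j (∂K_i/∂u_j) g_j` (Euclidean). -/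
noncomputable def LapE (W : Weights S) (α : ℝ) (u : Fin N → ℝ) (g : Fin N → ℝ)
    (i : Fin N) : ℝ :=
  -exp (-(α * u i)) * ∑ j, DKE W u i j * g j

/-! ### Hyperbolic background -/

/-- The inverse hyperbolic cosine. -/
noncomputable def arcosh (x : ℝ) : ℝ := Real.log (x + Real.sqrt (x ^ 2 - 1))

/-- Hyperbolic edge length
`l_ij = arcosh(sqrt((1+ε_i e^{2f_i})(1+ε_j e^{2f_j})) + η_ij e^{f_i+f_j})`. -/
noncomputable def lH (W : Weights S) (f : Fin N → ℝ) (i j : Fin N) : ℝ :=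
  arcosh (Real.sqrt ((1 + W.eps i * exp (2 * f i)) * (1 + W.eps j * exp (2 * f j))) +
    W.eta i j * exp (f i + f j))

open Classical in
/-- The coordinate change `f ↦ u` at a vertex with scheme coefficient `e`. -/
noncomputable def ucoord (e x : ℝ) : ℝ :=
  if e = 0 then x
  else (1 / 2) * Real.log ((Real.sqrt (1 + exp (2 * x)) - 1) / (Real.sqrt (1 + exp (2 * x)) + 1))

/-- The discrete conformal structure `u` associated to the conformal factor `f`
(hyperbolic background). -/
noncomputable def uOf (W : Weights S) (f : Fin N → ℝ) (i : Fin N) : ℝ :=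
  ucoord (W.eps i) (f i)

/-- The admissible space `U^H` (described in the `f`-coordinates): every face satisfies
the strict triangle inequalities. -/
def admissibleH (W : Weights S) (f : Fin N → ℝ) : Prop :=
  ∀ i j k : Fin N, ({i, j, k} : Finset (Fin N)) ∈ S.F →
    lH W f i j + lH W f i k > lH W f j k

/-- The inner angle `θ_i^{jk}` at `i` in the hyperbolic face `{i,j,k}`, by the hyperbolic
law of cosines. -/
noncomputable def thetaH (W : Weights S) (f : Fin N → ℝ) (i j k : Fin N) : ℝ :=
  arccos ((Real.cosh (lH W f i j) * Real.cosh (lH W f i k) - Real.cosh (lH W f j k)) /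
    (Real.sinh (lH W f i j) * Real.sinh (lH W f i k)))

open Classical in
/-- The extended hyperbolic inner angle `θ̃_i^{jk}`. -/
noncomputable def thetaExH (W : Weights S) (f : Fin N → ℝ) (i j k : Fin N) : ℝ :=
  if lH W f i j + lH W f i k > lH W f j k ∧ lH W f i j + lH W f j k > lH W f i k ∧
      lH W f i k + lH W f j k > lH W f i j then thetaH W f i j k
  else if lH W f j k ≥ lH W f i j + lH W f i k then π else 0

open Classical in
/-- The angle at `i` in a hyperbolic face `σ` containing `i`. -/
noncomputable def faceAngleH (W : Weights S) (f : Fin N → ℝ) (i : Fin N)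
    (σ : Finset (Fin N)) : ℝ :=
  (1 / 2) * ∑ j ∈ σ.erase i, ∑ k ∈ (σ.erase i).erase j, thetaH W f i j k

open Classical in
/-- The extended angle at `i` in a hyperbolic face `σ` containing `i`. -/
noncomputable def faceAngleExH (W : Weights S) (f : Fin N → ℝ) (i : Fin N)
    (σ : Finset (Fin N)) : ℝ :=
  (1 / 2) * ∑ j ∈ σ.erase i, ∑ k ∈ (σ.erase i).erase j, thetaExH W f i j k

open Classical in
/-- The classical combinatorial curvature (hyperbolic background). -/
noncomputable def KH (W : Weights S) (f : Fin N → ℝ) (i : Fin N) : ℝ :=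
  2 * π - ∑ σ ∈ S.F.filter (fun σ => i ∈ σ), faceAngleH W f i σ

open Classical in
/-- The extended combinatorial curvature (hyperbolic background). -/
noncomputable def KExH (W : Weights S) (f : Fin N → ℝ) (i : Fin N) : ℝ :=
  2 * π - ∑ σ ∈ S.F.filter (fun σ => i ∈ σ), faceAngleExH W f i σ

/-- The combinatorial `α`-curvature `R_{α,i} = K_i e^{−α u_i}` (hyperbolic background),
expressed as a function of the conformal factor `f`. -/
noncomputable def RH (W : Weights S) (α : ℝ) (f : Fin N → ℝ) (i : Fin N) : ℝ :=
  KH W f i * exp (-(α * uOf W f i))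

/-- The extended combinatorial `α`-curvature `R̃_{α,i} = K̃_i e^{−α u_i}` (hyperbolic). -/
noncomputable def RExH (W : Weights S) (α : ℝ) (f : Fin N → ℝ) (i : Fin N) : ℝ :=
  KExH W f i * exp (-(α * uOf W f i))

/-- The Jacobian `∂K_i/∂u_j` in the hyperbolic background, computed by the chain rule from
the `f`-coordinates: `(∂K_i/∂f_j) / (du_j/df_j)`. -/
noncomputable def DKH (W : Weights S) (f : Fin N → ℝ) (i j : Fin N) : ℝ :=
  fderiv ℝ (fun g => KH W g i) f (Pi.single j 1) / deriv (ucoord (W.eps j)) (f j)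

/-- The discrete `α`-Laplacian `(Δ_α g)_i = −e^{−α u_i} Σ_j (∂K_i/∂u_j) g_j` (hyperbolic). -/
noncomputable def LapH (W : Weights S) (α : ℝ) (f : Fin N → ℝ) (g : Fin N → ℝ)
    (i : Fin N) : ℝ :=
  -exp (-(α * uOf W f i)) * ∑ j, DKH W f i j * g j

/-- The Euclidean norm on `Fin N → ℝ`. -/
noncomputable def enorm (v : Fin N → ℝ) : ℝ := Real.sqrt (∑ i, v i ^ 2)

end TriSurface

open TriSurface

/-- A global solution of the Euclidean combinatorial `α`-Calabi flow
`du_i/dt = (Δ_α R_α)_i` staying in the admissible space `U^E`. -/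
def IsCalabiSolE {N : ℕ} {S : TriSurface N} (W : TriSurface.Weights S) (α : ℝ)
    (u : ℝ → Fin N → ℝ) : Prop :=
  (∀ t ∈ Set.Ici (0 : ℝ), admissibleE W (u t)) ∧
  ∀ t ∈ Set.Ici (0 : ℝ), ∀ i, HasDerivWithinAt (fun s => u s i)
    (LapE W α (u t) (RE W α (u t)) i) (Set.Ici (0 : ℝ)) t

/-- A global solution of the Euclidean normalized combinatorial `α`-Ricci flow
`du_i/dt = 2πχ/(Σ_j e^{α u_j}) − R_{α,i}(u)` staying in the admissible space `U^E`. -/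
def IsNormRicciSolE {N : ℕ} {S : TriSurface N} (W : TriSurface.Weights S) (α : ℝ)
    (u : ℝ → Fin N → ℝ) : Prop :=
  (∀ t ∈ Set.Ici (0 : ℝ), admissibleE W (u t)) ∧
  ∀ t ∈ Set.Ici (0 : ℝ), ∀ i, HasDerivWithinAt (fun s => u s i)
    (2 * Real.pi * (S.chi : ℝ) / (∑ j, Real.exp (α * u t j)) - RE W α (u t) i)
    (Set.Ici (0 : ℝ)) t

/-- Exponential convergence of a flow to `ū`. -/
def ExpConvergesTo {N : ℕ} (u : ℝ → Fin N → ℝ) (ubar : Fin N → ℝ) : Prop :=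
  ∃ C > (0 : ℝ), ∃ β > (0 : ℝ), ∀ t ≥ (0 : ℝ),
    TriSurface.enorm (fun i => u t i - ubar i) ≤ C * Real.exp (-β * t)

/-- Continuous functions whose derivative is nonpositive wherever the value avoids a finite set
are antitone. -/
theorem antitone_of_deriv_nonpos_off_finite_values {f : ℝ → ℝ} (hf : Continuous f) {Z : Set ℝ}
    (hZ : Z.Finite) (hd : ∀ t, f t ∉ Z → ∃ d ≤ 0, HasDerivAt f d t) : Antitone f := by
  intro a b hab
  by_contra! hlt
  have hab' : a ≤ b := hab
  obtain ⟨y, hy, hyZ⟩ : ∃ y ∈ Set.Ioo (f a) (f b), y ∉ Z :=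
    ((Set.Ioo_infinite hlt).sdiff hZ).nonempty
  have hcomp : IsCompact (Set.Icc a b ∩ f ⁻¹' Set.Iic y) :=
    isCompact_Icc.inter_right (isClosed_Iic.preimage hf)
  obtain ⟨t, ⟨⟨hta, htb⟩, hty⟩, hmax⟩ :=
    hcomp.exists_isGreatest ⟨a, ⟨le_rfl, hab'⟩, hy.1.le⟩
  have hty : f t ≤ y := hty
  have htb' : t < b := lt_of_le_of_ne htb (by rintro rfl; linarith [hy.2])
  have hgt : ∀ s, t < s → s ≤ b → y < f s := by
    intro s hs hsb
    by_contra! h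
    exact absurd (hmax ⟨⟨hta.trans hs.le, hsb⟩, h⟩) (not_le.mpr hs)
  have heq : f t = y := by
    refine le_antisymm hty ?_
    by_contra! h
    have hev : ∀ᶠ s in nhds t, f s < y := hf.continuousAt.eventually (gt_mem_nhds h)
    have hev' : ∀ᶠ s in nhdsWithin t (Set.Ioi t), f s < y ∧ s ∈ Set.Ioc t b :=
      (hev.filter_mono nhdsWithin_le_nhds).and (Ioc_mem_nhdsGT htb')
    obtain ⟨s, hs1, hs2⟩ := hev'.exists
    exact absurd (hgt s hs2.1 hs2.2) (not_lt.mpr hs1.le)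
  have hopen : ∀ᶠ s in nhds t, f s ∉ Z :=
    hf.continuousAt.eventually (hZ.isClosed.isOpen_compl.mem_nhds (by rwa [heq]))
  obtain ⟨e, he, hball⟩ := Metric.eventually_nhds_iff.mp hopen
  set s := min b (t + e / 2) with hs
  have hts : t < s := lt_min htb' (by linarith)
  have hse : s ≤ t + e / 2 := min_le_right _ _
  have hder : ∀ x ∈ Set.Icc t s, ∃ d ≤ 0, HasDerivAt f d x := by
    intro x hx
    refine hd x (hball ?_)
    rw [Real.dist_eq, abs_of_nonneg (by linarith [hx.1])]
    linarith [hx.2]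
  have hanti : AntitoneOn f (Set.Icc t s) := by
    refine antitoneOn_of_deriv_nonpos (convex_Icc t s) hf.continuousOn ?_ ?_
    · intro x hx
      obtain ⟨d, -, h⟩ := hder x (interior_subset hx)
      exact h.differentiableAt.differentiableWithinAt
    · intro x hx
      obtain ⟨d, hd0, h⟩ := hder x (interior_subset hx)
      rwa [h.deriv]
  have h1 := hanti ⟨le_rfl, hts.le⟩ ⟨hts.le, le_rfl⟩ hts.le
  have h2 := hgt s hts (min_le_left _ _)
  linarith

/-- Exponential decay from a linear differential inequality. -/
theorem le_mul_exp_of_deriv_le {V V' : ℝ → ℝ} {k T : ℝ} (hT : 0 ≤ T)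
    (hV : ∀ t ∈ Set.Icc 0 T, HasDerivWithinAt V (V' t) (Set.Ici 0) t)
    (hle : ∀ t ∈ Set.Icc 0 T, V' t ≤ -k * V t) : V T ≤ V 0 * exp (-k * T) := by
  have hcont : ContinuousOn V (Set.Icc 0 T) := fun t ht =>
    ((hV t ht).continuousWithinAt).mono Set.Icc_subset_Ici_self
  have hanti : AntitoneOn (fun t => V t * exp (k * t)) (Set.Icc 0 T) := by
    have hder : ∀ t ∈ interior (Set.Icc 0 T), HasDerivAt (fun t => V t * exp (k * t))
        (V' t * exp (k * t) + V t * (exp (k * t) * (k * 1))) t := by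
      intro t ht
      rw [interior_Icc] at ht
      have h1 : HasDerivAt V (V' t) t :=
        (hV t ⟨ht.1.le, ht.2.le⟩).hasDerivAt (Ici_mem_nhds ht.1)
      exact h1.mul ((hasDerivAt_id t).const_mul k).exp
    refine antitoneOn_of_deriv_nonpos (convex_Icc 0 T) (hcont.mul (by fun_prop)) ?_ ?_
    · exact fun t ht => (hder t ht).differentiableAt.differentiableWithinAt
    · intro t ht
      rw [(hder t ht).deriv]
      have := hle t (interior_subset ht)
      have he := exp_pos (k * t)
      nlinarith
  have h := hanti ⟨le_rfl, hT⟩ ⟨hT, le_rfl⟩ hT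
  simp only [mul_zero, exp_zero, mul_one] at h
  have he : exp (-k * T) = (exp (k * T))⁻¹ := by rw [← exp_neg]; ring_nf
  rw [he]
  exact (le_mul_inv_iff₀ (exp_pos _)).mpr h

/-- A bound that holds as long as `V` stays below a level `c` and which keeps `V` below `V 0 < c`
holds forever. -/
theorem le_of_bootstrap {V : ℝ → ℝ} {c : ℝ} (hV : ContinuousOn V (Set.Ici 0)) (h0 : V 0 < c)
    (hstep : ∀ T, 0 ≤ T → (∀ t ∈ Set.Icc 0 T, V t ≤ c) → V T ≤ V 0) :
    ∀ t, 0 ≤ t → V t ≤ c := by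
  intro T hT
  by_contra! hlt
  have hcT : ContinuousOn V (Set.Icc 0 T) := hV.mono Set.Icc_subset_Ici_self
  have hcomp : IsCompact (Set.Icc 0 T ∩ V ⁻¹' Set.Ici c) :=
    isCompact_Icc.of_isClosed_subset (hcT.preimage_isClosed_of_isClosed isClosed_Icc isClosed_Ici)
      Set.inter_subset_left
  obtain ⟨s, ⟨⟨hs0, hsT⟩, hsc⟩, hmin⟩ := hcomp.exists_isLeast ⟨T, ⟨hT, le_rfl⟩, hlt.le⟩
  have hsc : c ≤ V s := hsc
  have hbelow : ∀ t, 0 ≤ t → t < s → V t < c := by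
    intro t ht hts
    by_contra! h
    exact absurd (hmin ⟨⟨ht, hts.le.trans hsT⟩, h⟩) (not_le.mpr hts)
  have hseq : V s ≤ c := by
    by_contra! h
    have hcs : ContinuousOn V (Set.Icc 0 s) := hV.mono Set.Icc_subset_Ici_self
    obtain ⟨t, ht, hte⟩ := intermediate_value_Icc hs0 hcs ⟨h0.le, h.le⟩
    rcases ht.2.lt_or_eq with h' | h'
    · exact absurd hte (hbelow t ht.1 h').ne
    · rw [h'] at hte; linarith
  have := hstep s hs0 (fun t ht => by
    rcases ht.2.lt_or_eq with h' | h'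
    · exact (hbelow t ht.1 h').le
    · rwa [h'])
  linarith

/-- A bounded, globally Lipschitz autonomous vector field has a forward global solution. -/
theorem exists_forward_solution_of_lipschitz_of_bounded {E : Type*} [NormedAddCommGroup E]
    [NormedSpace ℝ E] [CompleteSpace E] {f : E → E} {K L : NNReal} (hf : LipschitzWith K f)
    (hL : ∀ x, ‖f x‖ ≤ L) (x₀ : E) :
    ∃ u : ℝ → E, u 0 = x₀ ∧ ∀ t ∈ Set.Ici (0 : ℝ), HasDerivWithinAt u (f (u t)) (Set.Ici 0) t := by
  have hex : ∀ n : ℕ, ∃ u : ℝ → E, u 0 = x₀ ∧ ∀ t ∈ Set.Icc (0 : ℝ) (n + 1),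
      HasDerivWithinAt u (f (u t)) (Set.Icc 0 (n + 1 : ℝ)) t := by
    intro n
    have hn : (0 : ℝ) ≤ n + 1 := by positivity
    have hPL : IsPicardLindelof (fun _ => f) (⟨0, le_rfl, hn⟩ : Set.Icc (0 : ℝ) (n + 1)) x₀
        (L * (n + 1)) 0 L K :=
      IsPicardLindelof.of_time_independent (fun x _ => hL x) hf.lipschitzOnWith (by simp [hn])
    exact hPL.exists_eq_forall_mem_Icc_hasDerivWithinAt₀
  choose sol hsol0 hsol using hex
  have hright : ∀ n : ℕ, ∀ t ∈ Set.Ico (0 : ℝ) (n + 1),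
      HasDerivWithinAt (sol n) (f (sol n t)) (Set.Ici t) t := by
    intro n t ht
    have h1 := (hsol n t ⟨ht.1, ht.2.le⟩).mono
      (Set.Icc_subset_Icc_left ht.1 : Set.Icc t (n + 1 : ℝ) ⊆ _)
    exact h1.mono_of_mem_nhdsWithin (Icc_mem_nhdsGE ht.2)
  have hagree : ∀ m n : ℕ, m ≤ n → Set.EqOn (sol m) (sol n) (Set.Icc 0 (m + 1 : ℝ)) := by
    intro m n hmn
    have hmn' : (m : ℝ) + 1 ≤ n + 1 := by exact_mod_cast Nat.succ_le_succ hmn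
    refine ODE_solution_unique (v := fun _ => f) (fun _ => hf)
      (fun t ht => (hsol m t ht).continuousWithinAt) (hright m)
      (fun t ht => ((hsol n t ⟨ht.1, ht.2.trans hmn'⟩).continuousWithinAt).mono
        (Set.Icc_subset_Icc_right hmn'))
      (fun t ht => hright n t ⟨ht.1, ht.2.trans_le hmn'⟩) (by rw [hsol0, hsol0])
  refine ⟨fun t => sol ⌊t⌋₊ t, by simp [hsol0], fun t ht => ?_⟩
  have ht : (0 : ℝ) ≤ t := ht
  set m := ⌊t⌋₊ + 1 with hm
  have htm : t < m := by rw [hm]; exact_mod_cast Nat.lt_floor_add_one t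
  have heq : ∀ s : ℝ, 0 ≤ s → s < m → sol ⌊s⌋₊ s = sol m s := by
    intro s hs hsm
    have : ⌊s⌋₊ < m := (Nat.floor_lt hs).mpr hsm
    exact hagree _ _ this.le ⟨hs, (Nat.lt_floor_add_one s).le⟩
  have h1 : HasDerivWithinAt (sol m) (f (sol m t)) (Set.Ici 0) t := by
    refine (hsol m t ⟨ht, by linarith⟩).mono_of_mem_nhdsWithin ?_
    rw [← Set.Ici_inter_Iic]
    exact Filter.inter_mem self_mem_nhdsWithin
      (mem_nhdsWithin_of_mem_nhds (Iic_mem_nhds (by linarith)))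
  simp only [heq t ht htm]
  refine h1.congr_of_eventuallyEq ?_ (heq t ht htm)
  filter_upwards [self_mem_nhdsWithin, mem_nhdsWithin_of_mem_nhds (Iio_mem_nhds htm)] with s hs hsm
  exact heq s hs hsm

theorem quad_len_pos {e₁ e₂ n r₁ r₂ : ℝ} (h₁ : e₁ = 0 ∨ e₁ = 1) (h₂ : e₂ = 0 ∨ e₂ = 1)
    (hn : e₁ * e₂ + n > 0) (hr₁ : 0 < r₁) (hr₂ : 0 < r₂) :
    0 < e₁ * r₁ ^ 2 + e₂ * r₂ ^ 2 + 2 * n * (r₁ * r₂) := by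
  have hr := mul_pos hr₁ hr₂
  rcases h₁ with rfl | rfl <;> rcases h₂ with rfl | rfl <;> norm_num at hn ⊢
  · positivity
  · positivity
  · positivity
  · nlinarith [sq_nonneg (r₁ - r₂), mul_pos hn hr]

/-- Derivative of the angle opposite to the side of squared length `c`, in terms of the squared
side lengths. -/
theorem hasDerivAt_arccos_sides {a b c : ℝ → ℝ} {a' b' c' t : ℝ} (ha : HasDerivAt a a' t)
    (hb : HasDerivAt b b' t) (hc : HasDerivAt c c' t) (hpa : 0 < a t) (hpb : 0 < b t)
    (hpc : 0 < c t) (hD : 0 < 4 * (a t * b t) - (a t + b t - c t) ^ 2) :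
    HasDerivAt (fun s => arccos ((√(a s) ^ 2 + √(b s) ^ 2 - √(c s) ^ 2) / (2 * √(a s) * √(b s))))
      ((c' - (c t + a t - b t) / (2 * a t) * a' - (c t + b t - a t) / (2 * b t) * b') /
        √(4 * (a t * b t) - (a t + b t - c t) ^ 2)) t := by
  have hsa := ha.sqrt hpa.ne'
  have hsb := hb.sqrt hpb.ne'
  have hsc := hc.sqrt hpc.ne'
  obtain ⟨p, hp⟩ : ∃ p, p = √(a t) := ⟨_, rfl⟩
  obtain ⟨q, hq⟩ : ∃ q, q = √(b t) := ⟨_, rfl⟩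
  obtain ⟨l, hl⟩ : ∃ l, l = √(c t) := ⟨_, rfl⟩
  have hp0 : 0 < p := hp ▸ sqrt_pos.mpr hpa
  have hq0 : 0 < q := hq ▸ sqrt_pos.mpr hpb
  have hl0 : 0 < l := hl ▸ sqrt_pos.mpr hpc
  have hpp : a t = p ^ 2 := by rw [hp, sq_sqrt hpa.le]
  have hqq : b t = q ^ 2 := by rw [hq, sq_sqrt hpb.le]
  have hll : c t = l ^ 2 := by rw [hl, sq_sqrt hpc.le]
  have hcos := ((hsa.pow 2).add (hsb.pow 2) |>.sub (hsc.pow 2)).div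
    ((hsa.const_mul 2).mul hsb) (by
      change 2 * √(a t) * √(b t) ≠ 0
      rw [← hp, ← hq]; positivity)
  simp only [Pi.add_apply, Pi.sub_apply, Pi.pow_apply, Pi.mul_apply, ← hp, ← hq, ← hl] at hcos
  set D := 4 * (a t * b t) - (a t + b t - c t) ^ 2 with hDdef
  set z := (p ^ 2 + q ^ 2 - l ^ 2) / (2 * p * q) with hz
  have hzD : 1 - z ^ 2 = D / (2 * p * q) ^ 2 := by
    rw [hz, hDdef, hpp, hqq, hll]; field_simp; ring
  have hsq : √(1 - z ^ 2) = √D / (2 * p * q) := by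
    rw [hzD, sqrt_div hD.le, sqrt_sq (by positivity)]
  have hlt : 0 < 1 - z ^ 2 := by rw [hzD]; positivity
  have hz1 : z ≠ -1 := by rintro h; rw [h] at hlt; norm_num at hlt
  have hz2 : z ≠ 1 := by rintro h; rw [h] at hlt; norm_num at hlt
  have hzt : (√(a t) ^ 2 + √(b t) ^ 2 - √(c t) ^ 2) / (2 * √(a t) * √(b t)) = z := by
    rw [← hp, ← hq, ← hl]
  have hacos := hasDerivAt_arccos hz1 hz2
  rw [← hzt] at hacos
  have key := hacos.comp t hcos
  refine key.congr_deriv ?_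
  have hsD : 0 < √D := sqrt_pos.mpr hD
  rw [hzt, hsq, hpp, hqq, hll]
  field_simp
  ring

theorem arccos_sides_eq_zero_or_pi {a b c : ℝ} (ha : 0 < a) (hb : 0 < b) (hc : 0 < c)
    (hD : 4 * (a * b) - (a + b - c) ^ 2 ≤ 0) :
    arccos ((√a ^ 2 + √b ^ 2 - √c ^ 2) / (2 * √a * √b)) = 0 ∨
      arccos ((√a ^ 2 + √b ^ 2 - √c ^ 2) / (2 * √a * √b)) = π := by
  rw [sq_sqrt ha.le, sq_sqrt hb.le, sq_sqrt hc.le]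
  have hpq : 0 < 2 * √a * √b := by positivity
  have hsq : (2 * √a * √b) ^ 2 = 4 * (a * b) := by
    rw [mul_pow, mul_pow, sq_sqrt ha.le, sq_sqrt hb.le]; ring
  have habs : 2 * √a * √b ≤ |a + b - c| := by
    rw [← abs_of_pos hpq]; exact sq_le_sq.mp (by rw [hsq]; linarith)
  rcases le_total 0 (a + b - c) with h | h
  · left
    rw [arccos_eq_zero, le_div_iff₀ hpq, one_mul]
    rwa [abs_of_nonneg h] at habs
  · right
    rw [arccos_eq_pi, div_le_iff₀ hpq]
    rw [abs_of_nonpos h] at habs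
    linarith

/-- The angles of a nondegenerate Euclidean triangle sum to `π`. -/
theorem arccos_sides_sum {p q l : ℝ} (hp : 0 < p) (hq : 0 < q) (hl : 0 < l)
    (hD : 0 < 4 * (p ^ 2 * q ^ 2) - (p ^ 2 + q ^ 2 - l ^ 2) ^ 2) :
    arccos ((p ^ 2 + q ^ 2 - l ^ 2) / (2 * p * q)) +
      arccos ((q ^ 2 + l ^ 2 - p ^ 2) / (2 * q * l)) +
      arccos ((l ^ 2 + p ^ 2 - q ^ 2) / (2 * l * p)) = π := by
  set D := 4 * (p ^ 2 * q ^ 2) - (p ^ 2 + q ^ 2 - l ^ 2) ^ 2 with hDdef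
  have hsD : 0 < √D := sqrt_pos.mpr hD
  have hDD : √D ^ 2 = D := sq_sqrt hD.le
  have aux : ∀ {x y z : ℝ}, 0 < x → 0 < y → 4 * (x ^ 2 * y ^ 2) - (x ^ 2 + y ^ 2 - z ^ 2) ^ 2 = D →
      ∃ A, arccos ((x ^ 2 + y ^ 2 - z ^ 2) / (2 * x * y)) = A ∧ 0 < A ∧ A < π ∧
        cos A = (x ^ 2 + y ^ 2 - z ^ 2) / (2 * x * y) ∧ sin A = √D / (2 * x * y) := by
    intro x y z hx hy h
    have h1 : 1 - ((x ^ 2 + y ^ 2 - z ^ 2) / (2 * x * y)) ^ 2 = D / (2 * x * y) ^ 2 := by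
      rw [← h]; field_simp; ring
    have h2 : 0 < D / (2 * x * y) ^ 2 := by positivity
    have habs : |(x ^ 2 + y ^ 2 - z ^ 2) / (2 * x * y)| < 1 :=
      (sq_lt_one_iff_abs_lt_one _).mp (by linarith)
    have hc := cos_arccos (abs_lt.mp habs).1.le (abs_lt.mp habs).2.le
    have hs : sin (arccos ((x ^ 2 + y ^ 2 - z ^ 2) / (2 * x * y))) = √D / (2 * x * y) := by
      rw [sin_arccos, h1, sqrt_div hD.le, sqrt_sq (by positivity)]
    refine ⟨_, rfl, arccos_pos.mpr (abs_lt.mp habs).2, ?_, hc, hs⟩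
    refine lt_of_le_of_ne (arccos_le_pi _) fun he => ?_
    rw [he, sin_pi] at hs
    have : 0 < √D / (2 * x * y) := by positivity
    linarith
  obtain ⟨A, hA, hA0, hA1, hcA, hsA⟩ := aux (z := l) hp hq rfl
  obtain ⟨B, hB, hB0, hB1, hcB, hsB⟩ := aux (z := p) hq hl (by rw [hDdef]; ring)
  obtain ⟨C, hC, hC0, hC1, hcC, hsC⟩ := aux (z := q) hl hp (by rw [hDdef]; ring)
  rw [hA, hB, hC]
  have hsAB : sin (A + B) = sin C := by
    rw [sin_add, hcA, hsA, hcB, hsB, hsC]; field_simp; ring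
  have hcAB : cos (A + B) = cos (π - C) := by
    rw [cos_add, cos_pi_sub, hcA, hsA, hcB, hsB, hcC]
    have : √D / (2 * p * q) * (√D / (2 * q * l)) = D / (2 * p * q * (2 * q * l)) := by
      rw [div_mul_div_comm, ← sq, hDD]
    rw [this, hDdef]; field_simp; ring
  have hAB : A + B ≤ π := by
    by_contra! h
    have h1 : sin (A + B) < 0 := by
      have := sin_pos_of_pos_of_lt_pi (x := A + B - π) (by linarith) (by linarith)
      rw [sin_sub_pi] at this; linarith
    have := sin_pos_of_pos_of_lt_pi hC0 hC1
    linarith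
  have := injOn_cos ⟨by linarith, hAB⟩ ⟨by linarith, by linarith⟩ hcAB
  linarith

/-- The numerator of the conductance of the edge `12` in the triangle `123`. -/
def edgeNum (e₁ e₂ n₁₂ n₁₃ n₂₃ r₁ r₂ r₃ : ℝ) : ℝ :=
  (e₁ * e₂ - n₁₂ ^ 2) * (r₁ ^ 2 * r₂ ^ 2) + (e₁ * n₂₃ + n₁₂ * n₁₃) * (r₂ * r₃ * r₁ ^ 2) +
    (e₂ * n₁₃ + n₁₂ * n₂₃) * (r₁ * r₃ * r₂ ^ 2)

/-- A weighted triangle Laplacian with positive second symmetric function of the conductances and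
positive Dirichlet energy of the triangle itself is positive definite modulo constants. -/
theorem triangle_energy {w₁ w₂ w₃ L₁ L₂ L₃ : ℝ} (hL₁ : 0 < L₁) (hL₂ : 0 < L₂)
    (hD : 0 < 4 * (L₁ * L₂) - (L₁ + L₂ - L₃) ^ 2) (hS : 0 < w₁ * w₂ + w₂ * w₃ + w₃ * w₁)
    (hsum : 0 < w₁ * L₁ + w₂ * L₂ + w₃ * L₃) (x₁ x₂ x₃ : ℝ) :
    0 ≤ w₃ * (x₁ - x₂) ^ 2 + w₂ * (x₁ - x₃) ^ 2 + w₁ * (x₂ - x₃) ^ 2 ∧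
      (w₃ * (x₁ - x₂) ^ 2 + w₂ * (x₁ - x₃) ^ 2 + w₁ * (x₂ - x₃) ^ 2 = 0 →
        x₁ = x₂ ∧ x₁ = x₃) := by
  have hw : 0 < w₁ + w₃ := by
    obtain ⟨d, hd⟩ : ∃ d, L₁ + L₂ - L₃ = 2 * d := ⟨(L₁ + L₂ - L₃) / 2, by ring⟩
    have hL₃ : L₃ = L₁ + L₂ - 2 * d := by linarith
    rw [hd] at hD
    have h1 : 0 ≤ (w₁ + w₃) ^ 2 * L₁ - 2 * (w₁ + w₃) * w₃ * d + w₃ ^ 2 * L₂ := by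
      have h2 : 0 ≤ L₁ * ((w₁ + w₃) ^ 2 * L₁ - 2 * (w₁ + w₃) * w₃ * d + w₃ ^ 2 * L₂) := by
        have h3 : 0 ≤ w₃ ^ 2 * (L₁ * L₂ - d ^ 2) := mul_nonneg (sq_nonneg _) (by nlinarith)
        nlinarith [sq_nonneg ((w₁ + w₃) * L₁ - w₃ * d)]
      exact nonneg_of_mul_nonneg_right h2 hL₁
    have h4 : (w₁ + w₃) * (w₁ * L₁ + w₂ * L₂ + w₃ * L₃) =
        ((w₁ + w₃) ^ 2 * L₁ - 2 * (w₁ + w₃) * w₃ * d + w₃ ^ 2 * L₂) +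
          (w₁ * w₂ + w₂ * w₃ + w₃ * w₁) * L₂ := by rw [hL₃]; ring
    have h5 : 0 < (w₁ + w₃) * (w₁ * L₁ + w₂ * L₂ + w₃ * L₃) := by
      rw [h4]; have := mul_pos hS hL₂; linarith
    exact pos_of_mul_pos_left h5 hsum.le
  have hid : (w₁ + w₃) * (w₃ * (x₁ - x₂) ^ 2 + w₂ * (x₁ - x₃) ^ 2 + w₁ * (x₂ - x₃) ^ 2) =
      ((w₁ + w₃) * (x₂ - x₃) - w₃ * (x₁ - x₃)) ^ 2 +
        (w₁ * w₂ + w₂ * w₃ + w₃ * w₁) * (x₁ - x₃) ^ 2 := by ring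
  constructor
  · refine nonneg_of_mul_nonneg_right ?_ hw
    rw [hid]; positivity
  · intro h0
    rw [h0, mul_zero] at hid
    have h1 : 0 ≤ (w₁ * w₂ + w₂ * w₃ + w₃ * w₁) * (x₁ - x₃) ^ 2 := by positivity
    have h2 := sq_nonneg ((w₁ + w₃) * (x₂ - x₃) - w₃ * (x₁ - x₃))
    have h3 : (w₁ * w₂ + w₂ * w₃ + w₃ * w₁) * (x₁ - x₃) ^ 2 = 0 := by linarith
    have h4 : x₁ - x₃ = 0 := by simpa [hS.ne'] using h3
    rw [h4] at hid
    have h5 : (w₁ + w₃) * (x₂ - x₃) = 0 := by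
      have : ((w₁ + w₃) * (x₂ - x₃)) ^ 2 = 0 := by nlinarith
      simpa using this
    have h6 : x₂ - x₃ = 0 := by simpa [hw.ne'] using h5
    constructor <;> linarith

/-- Positivity of the cofactor controlling the definiteness of the angle Jacobian. -/
theorem structure_form_pos {e₁ e₂ e₃ n₁₂ n₁₃ n₂₃ r₁ r₂ r₃ : ℝ} (h₁ : e₁ = 0 ∨ e₁ = 1)
    (h₂ : e₂ = 0 ∨ e₂ = 1) (h₃ : e₃ = 0 ∨ e₃ = 1) (h12 : e₁ * e₂ + n₁₂ > 0)
    (h13 : e₁ * e₃ + n₁₃ > 0) (h23 : e₂ * e₃ + n₂₃ > 0) (g₁ : e₁ * n₂₃ + n₁₂ * n₁₃ ≥ 0)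
    (g₂ : e₂ * n₁₃ + n₁₂ * n₂₃ ≥ 0) (g₃ : e₃ * n₁₂ + n₁₃ * n₂₃ ≥ 0)
    (hr₁ : 0 < r₁) (hr₂ : 0 < r₂) (hr₃ : 0 < r₃) :
    0 < 2 * (e₁ * e₂ * e₃ + n₁₂ * n₁₃ * n₂₃) * (r₁ * r₂ * r₃) ^ 2 +
      (e₁ * n₂₃ + n₁₂ * n₁₃) * (r₁ ^ 2 * (r₂ * r₃)) * (e₂ * r₂ ^ 2 + e₃ * r₃ ^ 2) +
      (e₂ * n₁₃ + n₁₂ * n₂₃) * (r₂ ^ 2 * (r₁ * r₃)) * (e₁ * r₁ ^ 2 + e₃ * r₃ ^ 2) +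
      (e₃ * n₁₂ + n₁₃ * n₂₃) * (r₃ ^ 2 * (r₁ * r₂)) * (e₁ * r₁ ^ 2 + e₂ * r₂ ^ 2) := by
  have p23 : 0 < r₂ * r₃ := by positivity
  have p13 : 0 < r₁ * r₃ := by positivity
  have p12 : 0 < r₁ * r₂ := by positivity
  have k : ∀ {g e f x y z : ℝ}, 0 ≤ g → (e = 0 ∨ e = 1) → (f = 0 ∨ f = 1) → 0 < x → 0 < y → 0 < z →
      g * (x ^ 2 * (y * z)) * (e * y ^ 2 + f * z ^ 2) ≥ 2 * (g * e * f) * (x * y * z) ^ 2 := by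
    intro g e f x y z hg he hf hx hy hz
    have h0 : 0 ≤ g * (x ^ 2 * (y * z)) := by positivity
    have h1 : e * y ^ 2 + f * z ^ 2 ≥ 2 * (e * f) * (y * z) := by
      rcases he with rfl | rfl <;> rcases hf with rfl | rfl <;>
        nlinarith [sq_nonneg (y - z), sq_nonneg y, sq_nonneg z]
    calc _ ≥ g * (x ^ 2 * (y * z)) * (2 * (e * f) * (y * z)) := mul_le_mul_of_nonneg_left h1 h0
      _ = _ := by ring
  have k1 := k g₁ h₂ h₃ hr₁ hr₂ hr₃
  have k2 := k g₂ h₁ h₃ hr₂ hr₁ hr₃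
  have k3 := k g₃ h₁ h₂ hr₃ hr₁ hr₂
  have hR : 0 < (r₁ * r₂ * r₃) ^ 2 := by positivity
  have hfac : 0 < e₁ * e₂ * e₃ + n₁₂ * n₁₃ * n₂₃ + (e₁ * n₂₃ + n₁₂ * n₁₃) * e₂ * e₃ +
      (e₂ * n₁₃ + n₁₂ * n₂₃) * e₁ * e₃ + (e₃ * n₁₂ + n₁₃ * n₂₃) * e₁ * e₂ := by
    have hprod := mul_pos (mul_pos h12 h13) h23
    refine hprod.trans_eq ?_
    rcases h₁ with rfl | rfl <;> rcases h₂ with rfl | rfl <;> rcases h₃ with rfl | rfl <;> ring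
  have hpos := mul_pos hfac hR
  have e2 : (r₂ * r₁ * r₃) ^ 2 = (r₁ * r₂ * r₃) ^ 2 := by ring
  have e3 : (r₃ * r₁ * r₂) ^ 2 = (r₁ * r₂ * r₃) ^ 2 := by ring
  rw [e2] at k2
  rw [e3] at k3
  linarith

namespace TriSurface

variable {N : ℕ} {S : TriSurface N}

theorem face_ne {i j k : Fin N} (h : ({i, j, k} : Finset (Fin N)) ∈ S.F) :
    i ≠ j ∧ i ≠ k ∧ j ≠ k := by
  have := S.card_face _ h
  have hle : ∀ x y : Fin N, ({x, y} : Finset (Fin N)).card ≠ 3 := fun x y h => by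
    have := Finset.card_le_two (a := x) (b := y)
    omega
  refine ⟨?_, ?_, ?_⟩ <;> rintro rfl
  · exact hle i k (by simpa using this)
  · exact hle j i (by simpa using this)
  · exact hle i j (by simpa using this)

theorem face_rot {i j k : Fin N} (h : ({i, j, k} : Finset (Fin N)) ∈ S.F) :
    ({j, k, i} : Finset (Fin N)) ∈ S.F := by
  convert h using 1; ext x; simp; tauto

theorem face_swap {i j k : Fin N} (h : ({i, j, k} : Finset (Fin N)) ∈ S.F) :
    ({i, k, j} : Finset (Fin N)) ∈ S.F := by
  convert h using 1; ext x; simp; tauto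

theorem edge_of_face {i j k : Fin N} (h : ({i, j, k} : Finset (Fin N)) ∈ S.F) :
    ({i, j} : Finset (Fin N)) ∈ S.edges := by
  refine Finset.mem_biUnion.mpr ⟨_, h, Finset.mem_powersetCard.mpr ⟨?_, ?_⟩⟩
  · intro x; simp; tauto
  · exact Finset.card_pair (face_ne h).1

/-- The squared edge length. -/
noncomputable def lenSq (W : Weights S) (u : Fin N → ℝ) (i j : Fin N) : ℝ :=
  W.eps i * exp (2 * u i) + W.eps j * exp (2 * u j) + 2 * W.eta i j * exp (u i + u j)

/-- Sixteen times the squared area of a triangle. -/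
noncomputable def disc (W : Weights S) (u : Fin N → ℝ) (i j k : Fin N) : ℝ :=
  4 * (lenSq W u i j * lenSq W u i k) - (lenSq W u i j + lenSq W u i k - lenSq W u j k) ^ 2

/-- The conductance of the edge `ij` in the face `ijk`, i.e. the derivative of `θ_i` in
direction `u_j`. -/
noncomputable def conductance (W : Weights S) (u : Fin N → ℝ) (i j k : Fin N) : ℝ :=
  2 * edgeNum (W.eps i) (W.eps j) (W.eta i j) (W.eta i k) (W.eta j k) (exp (u i)) (exp (u j))
    (exp (u k)) / (lenSq W u i j * √(disc W u i j k))

variable (W : Weights S)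

theorem lenSq_symm (u : Fin N → ℝ) (i j : Fin N) : lenSq W u i j = lenSq W u j i := by
  unfold lenSq; rw [W.eta_symm i j, add_comm (u i)]; ring

theorem lenSq_eq (u : Fin N → ℝ) (i j : Fin N) : lenSq W u i j =
    W.eps i * exp (u i) ^ 2 + W.eps j * exp (u j) ^ 2 +
      2 * W.eta i j * (exp (u i) * exp (u j)) := by
  unfold lenSq; rw [exp_add, ← exp_nat_mul, ← exp_nat_mul]; norm_num

theorem lE_eq (u : Fin N → ℝ) (i j : Fin N) : lE W u i j = √(lenSq W u i j) := rfl

theorem thetaE_eq (u : Fin N → ℝ) (i j k : Fin N) : thetaE W u i j k =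
    arccos ((√(lenSq W u i j) ^ 2 + √(lenSq W u i k) ^ 2 - √(lenSq W u j k) ^ 2) /
      (2 * √(lenSq W u i j) * √(lenSq W u i k))) := rfl

theorem thetaE_symm (u : Fin N → ℝ) (i j k : Fin N) : thetaE W u i j k = thetaE W u i k j := by
  rw [thetaE_eq, thetaE_eq, lenSq_symm W u j k]; ring_nf

theorem disc_swap (u : Fin N → ℝ) (i j k : Fin N) : disc W u i k j = disc W u i j k := by
  unfold disc; rw [lenSq_symm W u k j]; ring

theorem disc_rot (u : Fin N → ℝ) (i j k : Fin N) : disc W u j k i = disc W u i j k := by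
  unfold disc; rw [lenSq_symm W u j i, lenSq_symm W u k i]; ring

theorem conductance_symm (u : Fin N → ℝ) (i j k : Fin N) :
    conductance W u j i k = conductance W u i j k := by
  unfold conductance edgeNum
  rw [lenSq_symm W u j i, ← disc_rot W u j i k, disc_swap W u i j k, W.eta_symm j i]; ring_nf

theorem lenSq_pos (u : Fin N → ℝ) {i j k : Fin N} (h : ({i, j, k} : Finset (Fin N)) ∈ S.F) :
    0 < lenSq W u i j := by
  rw [lenSq_eq]
  exact quad_len_pos (W.eps01 i) (W.eps01 j) (W.structCond1 i j (edge_of_face h)) (exp_pos _)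
    (exp_pos _)

theorem lenSq_pos_face (u : Fin N → ℝ) {i j k : Fin N} (h : ({i, j, k} : Finset (Fin N)) ∈ S.F) :
    0 < lenSq W u i j ∧ 0 < lenSq W u i k ∧ 0 < lenSq W u j k :=
  ⟨lenSq_pos W u h, lenSq_pos W u (face_swap h), lenSq_pos W u (face_rot h)⟩

theorem disc_pos_of_admissible {u : Fin N → ℝ} (hu : admissibleE W u) {i j k : Fin N}
    (h : ({i, j, k} : Finset (Fin N)) ∈ S.F) : 0 < disc W u i j k := by
  obtain ⟨p1, p2, p3⟩ := lenSq_pos_face W u h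
  have t1 := hu i j k h
  have t2 := hu j k i (face_rot h)
  have t3 := hu k i j (face_rot (face_rot h))
  rw [lE_eq, lE_eq, lE_eq] at t1 t2 t3
  rw [lenSq_symm W u j i, lenSq_symm W u k i] at t2
  rw [lenSq_symm W u k i, lenSq_symm W u k j] at t3
  have q1 := sq_sqrt p1.le
  have q2 := sq_sqrt p2.le
  have q3 := sq_sqrt p3.le
  unfold disc
  set p := √(lenSq W u i j)
  set q := √(lenSq W u i k)
  set l := √(lenSq W u j k)
  rw [← q1, ← q2, ← q3]
  have hp : 0 < p := sqrt_pos.mpr p1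
  have hq : 0 < q := sqrt_pos.mpr p2
  have hl : 0 < l := sqrt_pos.mpr p3
  have : 0 < (p + q + l) * (p + q - l) * ((p + l - q) * (q + l - p)) :=
    mul_pos (mul_pos (by linarith) (by linarith)) (mul_pos (by linarith) (by linarith))
  calc 0 < _ := this
    _ = _ := by ring

theorem thetaE_zero_or_pi {u : Fin N → ℝ} {i j k : Fin N}
    (h : ({i, j, k} : Finset (Fin N)) ∈ S.F) (hD : disc W u i j k ≤ 0) :
    thetaE W u i j k = 0 ∨ thetaE W u i j k = π := by
  obtain ⟨p1, p2, p3⟩ := lenSq_pos_face W u h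
  exact arccos_sides_eq_zero_or_pi p1 p2 p3 hD

theorem continuous_lenSq (i j : Fin N) : Continuous fun u : Fin N → ℝ => lenSq W u i j := by
  unfold lenSq; fun_prop

theorem contDiff_lenSq {n : ℕ∞} (i j : Fin N) :
    ContDiff ℝ n fun u : Fin N → ℝ => lenSq W u i j := by
  unfold lenSq; fun_prop

theorem continuous_thetaE {i j k : Fin N} (h : ({i, j, k} : Finset (Fin N)) ∈ S.F) :
    Continuous fun u : Fin N → ℝ => thetaE W u i j k := by
  have h1 := continuous_lenSq W i j
  have h2 := continuous_lenSq W i k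
  have h3 := continuous_lenSq W j k
  simp only [thetaE_eq]
  refine continuous_arccos.comp (Continuous.div (by fun_prop) (by fun_prop) fun u => ?_)
  obtain ⟨p1, p2, p3⟩ := lenSq_pos_face W u h
  positivity

theorem contDiffAt_thetaE {n : ℕ∞} {u : Fin N → ℝ} {i j k : Fin N}
    (h : ({i, j, k} : Finset (Fin N)) ∈ S.F) (hD : 0 < disc W u i j k) :
    ContDiffAt ℝ n (fun u : Fin N → ℝ => thetaE W u i j k) u := by
  obtain ⟨p1, p2, p3⟩ := lenSq_pos_face W u h
  have s1 := ((contDiff_lenSq W (n := n) i j).contDiffAt (x := u)).sqrt p1.ne'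
  have s2 := ((contDiff_lenSq W (n := n) i k).contDiffAt (x := u)).sqrt p2.ne'
  have s3 := ((contDiff_lenSq W (n := n) j k).contDiffAt (x := u)).sqrt p3.ne'
  have hz := ((s1.pow 2).add (s2.pow 2) |>.sub (s3.pow 2)).div
    ((contDiffAt_const (c := (2 : ℝ)).mul s1).mul s2) (by positivity)
  have hlt : ((√(lenSq W u i j) ^ 2 + √(lenSq W u i k) ^ 2 - √(lenSq W u j k) ^ 2) /
      (2 * √(lenSq W u i j) * √(lenSq W u i k))) ^ 2 < 1 := by
    rw [sq_sqrt p1.le, sq_sqrt p2.le, sq_sqrt p3.le, div_pow, mul_pow, mul_pow, sq_sqrt p1.le,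
      sq_sqrt p2.le, div_lt_one (by positivity)]
    unfold disc at hD
    linarith
  have hne : ∀ z : ℝ, z ^ 2 < 1 → z ≠ -1 ∧ z ≠ 1 := fun z hz =>
    ⟨by rintro rfl; norm_num at hz, by rintro rfl; norm_num at hz⟩
  exact ContDiffAt.comp u (contDiffAt_arccos (hne _ hlt).1 (hne _ hlt).2) hz

theorem hasDerivAt_lenSq_line (u x : Fin N → ℝ) (i j : Fin N) :
    HasDerivAt (fun s : ℝ => lenSq W (u + s • x) i j)
      (2 * W.eps i * exp (u i) ^ 2 * x i + 2 * W.eps j * exp (u j) ^ 2 * x j +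
        2 * W.eta i j * (exp (u i) * exp (u j)) * (x i + x j)) 0 := by
  have hl : ∀ i, HasDerivAt (fun s : ℝ => u i + s * x i) (x i) 0 := fun i => by
    simpa using ((hasDerivAt_id (0 : ℝ)).mul_const (x i)).const_add (u i)
  have h := ((((hl i).const_mul 2).exp.const_mul (W.eps i)).add
    (((hl j).const_mul 2).exp.const_mul (W.eps j))).add
    (((hl i).add (hl j)).exp.const_mul (2 * W.eta i j))
  simp only [lenSq, Pi.add_apply, Pi.smul_apply, smul_eq_mul]
  refine h.congr_deriv ?_
  simp only [Pi.add_apply, zero_mul, add_zero, exp_add]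
  rw [← exp_nat_mul, ← exp_nat_mul]
  push_cast
  ring

theorem hasDerivAt_thetaE_line {u : Fin N → ℝ} (x : Fin N → ℝ) {i j k : Fin N}
    (h : ({i, j, k} : Finset (Fin N)) ∈ S.F) (hD : 0 < disc W u i j k) :
    HasDerivAt (fun s : ℝ => thetaE W (u + s • x) i j k)
      (conductance W u i j k * (x j - x i) + conductance W u i k j * (x k - x i)) 0 := by
  obtain ⟨p1, p2, p3⟩ := lenSq_pos_face W u h
  have u0 : u + (0 : ℝ) • x = u := by simp
  have key := hasDerivAt_arccos_sides (hasDerivAt_lenSq_line W u x i j)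
    (hasDerivAt_lenSq_line W u x i k) (hasDerivAt_lenSq_line W u x j k) (by rwa [u0])
    (by rwa [u0]) (by rwa [u0]) (by rwa [u0])
  simp only [thetaE_eq]
  refine key.congr_deriv ?_
  rw [u0, conductance, conductance, disc_swap W u i j k]
  change _ / √(disc W u i j k) = _
  have hs : 0 < √(disc W u i j k) := sqrt_pos.mpr hD
  generalize √(disc W u i j k) = s at hs
  have e1 := lenSq_eq W u i j
  have e2 := lenSq_eq W u i k
  have e3 := lenSq_eq W u j k
  rw [W.eta_symm k j]
  generalize lenSq W u i j = a at *
  generalize lenSq W u i k = b at *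
  generalize lenSq W u j k = c at *
  generalize exp (u i) = p at *
  generalize exp (u j) = q at *
  generalize exp (u k) = r at *
  have hpoly : 2 * a * b * (2 * W.eps j * q ^ 2 * x j + 2 * W.eps k * r ^ 2 * x k +
        2 * W.eta j k * (q * r) * (x j + x k)) -
      b * (c + a - b) * (2 * W.eps i * p ^ 2 * x i + 2 * W.eps j * q ^ 2 * x j +
        2 * W.eta i j * (p * q) * (x i + x j)) -
      a * (c + b - a) * (2 * W.eps i * p ^ 2 * x i + 2 * W.eps k * r ^ 2 * x k +
        2 * W.eta i k * (p * r) * (x i + x k)) =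
      4 * b * edgeNum (W.eps i) (W.eps j) (W.eta i j) (W.eta i k) (W.eta j k) p q r * (x j - x i) +
      4 * a * edgeNum (W.eps i) (W.eps k) (W.eta i k) (W.eta i j) (W.eta j k) p r q *
        (x k - x i) := by
    rw [e1, e2, e3]
    unfold edgeNum
    ring
  generalize edgeNum _ _ _ _ _ p q r = A at *
  generalize edgeNum _ _ _ _ _ p r q = B at *
  field_simp
  linear_combination hpoly / 2

theorem fderiv_thetaE {u : Fin N → ℝ} (x : Fin N → ℝ) {i j k : Fin N}
    (h : ({i, j, k} : Finset (Fin N)) ∈ S.F) (hD : 0 < disc W u i j k) :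
    fderiv ℝ (fun u : Fin N → ℝ => thetaE W u i j k) u x =
      conductance W u i j k * (x j - x i) + conductance W u i k j * (x k - x i) := by
  have h1 := ((contDiffAt_thetaE W (n := 1) h hD).differentiableAt one_ne_zero).hasFDerivAt
  have h2 : HasDerivAt (fun s : ℝ => u + s • x) x 0 := by
    simpa using ((hasDerivAt_id (0 : ℝ)).smul_const x).const_add u
  have h3 := HasFDerivAt.comp_hasDerivAt_of_eq (x := (0 : ℝ)) h1 h2 (by simp)
  exact h3.unique (hasDerivAt_thetaE_line W x h hD)

end TriSurface

theorem edgeNum_sum (e₁ e₂ e₃ n₁₂ n₁₃ n₂₃ r₁ r₂ r₃ : ℝ) :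
    4 * (edgeNum e₁ e₂ n₁₂ n₁₃ n₂₃ r₁ r₂ r₃ + edgeNum e₁ e₃ n₁₃ n₁₂ n₂₃ r₁ r₃ r₂ +
      edgeNum e₂ e₃ n₂₃ n₁₂ n₁₃ r₂ r₃ r₁) =
    4 * ((e₁ * r₁ ^ 2 + e₂ * r₂ ^ 2 + 2 * n₁₂ * (r₁ * r₂)) *
      (e₁ * r₁ ^ 2 + e₃ * r₃ ^ 2 + 2 * n₁₃ * (r₁ * r₃))) -
      ((e₁ * r₁ ^ 2 + e₂ * r₂ ^ 2 + 2 * n₁₂ * (r₁ * r₂)) +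
      (e₁ * r₁ ^ 2 + e₃ * r₃ ^ 2 + 2 * n₁₃ * (r₁ * r₃)) -
      (e₂ * r₂ ^ 2 + e₃ * r₃ ^ 2 + 2 * n₂₃ * (r₂ * r₃))) ^ 2 := by
  unfold edgeNum
  ring

theorem edgeNum_mul_sum (e₁ e₂ e₃ n₁₂ n₁₃ n₂₃ r₁ r₂ r₃ : ℝ) :
    edgeNum e₁ e₃ n₁₃ n₁₂ n₂₃ r₁ r₃ r₂ * edgeNum e₂ e₃ n₂₃ n₁₂ n₁₃ r₂ r₃ r₁ *
        (e₁ * r₁ ^ 2 + e₂ * r₂ ^ 2 + 2 * n₁₂ * (r₁ * r₂)) +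
      edgeNum e₁ e₂ n₁₂ n₁₃ n₂₃ r₁ r₂ r₃ * edgeNum e₂ e₃ n₂₃ n₁₂ n₁₃ r₂ r₃ r₁ *
        (e₁ * r₁ ^ 2 + e₃ * r₃ ^ 2 + 2 * n₁₃ * (r₁ * r₃)) +
      edgeNum e₁ e₂ n₁₂ n₁₃ n₂₃ r₁ r₂ r₃ * edgeNum e₁ e₃ n₁₃ n₁₂ n₂₃ r₁ r₃ r₂ *
        (e₂ * r₂ ^ 2 + e₃ * r₃ ^ 2 + 2 * n₂₃ * (r₂ * r₃)) =
    (edgeNum e₁ e₂ n₁₂ n₁₃ n₂₃ r₁ r₂ r₃ + edgeNum e₁ e₃ n₁₃ n₁₂ n₂₃ r₁ r₃ r₂ +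
      edgeNum e₂ e₃ n₂₃ n₁₂ n₁₃ r₂ r₃ r₁) *
      (2 * (e₁ * e₂ * e₃ + n₁₂ * n₁₃ * n₂₃) * (r₁ * r₂ * r₃) ^ 2 +
      (e₁ * n₂₃ + n₁₂ * n₁₃) * (r₁ ^ 2 * (r₂ * r₃)) * (e₂ * r₂ ^ 2 + e₃ * r₃ ^ 2) +
      (e₂ * n₁₃ + n₁₂ * n₂₃) * (r₂ ^ 2 * (r₁ * r₃)) * (e₁ * r₁ ^ 2 + e₃ * r₃ ^ 2) +
      (e₃ * n₁₂ + n₁₃ * n₂₃) * (r₃ ^ 2 * (r₁ * r₂)) * (e₁ * r₁ ^ 2 + e₂ * r₂ ^ 2)) := by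
  unfold edgeNum
  ring

namespace TriSurface

variable {N : ℕ} {S : TriSurface N} (W : Weights S)

theorem disc_eq_edgeNum (u : Fin N → ℝ) (i j k : Fin N) : disc W u i j k =
    4 * (edgeNum (W.eps i) (W.eps j) (W.eta i j) (W.eta i k) (W.eta j k) (exp (u i)) (exp (u j))
      (exp (u k)) + edgeNum (W.eps i) (W.eps k) (W.eta i k) (W.eta i j) (W.eta j k) (exp (u i))
      (exp (u k)) (exp (u j)) + edgeNum (W.eps j) (W.eps k) (W.eta j k) (W.eta i j) (W.eta i k)
      (exp (u j)) (exp (u k)) (exp (u i))) := by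
  rw [edgeNum_sum, disc, lenSq_eq, lenSq_eq, lenSq_eq]

/-- The Dirichlet form of a nondegenerate face is positive definite modulo constants. -/
theorem face_form_pos {u : Fin N → ℝ} (x : Fin N → ℝ) {i j k : Fin N}
    (h : ({i, j, k} : Finset (Fin N)) ∈ S.F) (hD : 0 < disc W u i j k) :
    0 ≤ conductance W u i j k * (x i - x j) ^ 2 + conductance W u i k j * (x i - x k) ^ 2 +
        conductance W u j k i * (x j - x k) ^ 2 ∧
      (conductance W u i j k * (x i - x j) ^ 2 + conductance W u i k j * (x i - x k) ^ 2 +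
        conductance W u j k i * (x j - x k) ^ 2 = 0 → x i = x j ∧ x i = x k) := by
  obtain ⟨p1, p2, p3⟩ := lenSq_pos_face W u h
  obtain ⟨n1, n2, n3⟩ := face_ne h
  have hs : 0 < √(disc W u i j k) := sqrt_pos.mpr hD
  have hss : √(disc W u i j k) ^ 2 = disc W u i j k := sq_sqrt hD.le
  have hsum := disc_eq_edgeNum W u i j k
  have g2 := W.structCond2 j i k (by rw [Finset.insert_comm]; exact h) n1.symm n3 n2
  have g3 := W.structCond2 k i j (face_rot (face_rot h)) n2.symm n3.symm n1
  rw [W.eta_symm j i] at g2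
  rw [W.eta_symm k i, W.eta_symm k j] at g3
  have hP := structure_form_pos (W.eps01 i) (W.eps01 j) (W.eps01 k)
    (W.structCond1 i j (edge_of_face h)) (W.structCond1 i k (edge_of_face (face_swap h)))
    (W.structCond1 j k (edge_of_face (face_rot h))) (W.structCond2 i j k h n1 n2 n3) g2 g3
    (exp_pos (u i)) (exp_pos (u j)) (exp_pos (u k))
  have hmul := edgeNum_mul_sum (W.eps i) (W.eps j) (W.eps k) (W.eta i j) (W.eta i k) (W.eta j k)
    (exp (u i)) (exp (u j)) (exp (u k))
  rw [← lenSq_eq, ← lenSq_eq, ← lenSq_eq] at hmul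
  have hd : 0 < 4 * (lenSq W u j k * lenSq W u i k) -
      (lenSq W u j k + lenSq W u i k - lenSq W u i j) ^ 2 := by
    unfold disc at hD
    linarith
  have c3 : conductance W u i k j = 2 * edgeNum (W.eps i) (W.eps k) (W.eta i k) (W.eta i j)
      (W.eta j k) (exp (u i)) (exp (u k)) (exp (u j)) /
      (lenSq W u i k * √(disc W u i j k)) := by
    rw [conductance, disc_swap W u i j k, W.eta_symm k j]
  have c1 : conductance W u j k i = 2 * edgeNum (W.eps j) (W.eps k) (W.eta j k) (W.eta i j)
      (W.eta i k) (exp (u j)) (exp (u k)) (exp (u i)) /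
      (lenSq W u j k * √(disc W u i j k)) := by
    rw [conductance, disc_rot W u i j k, W.eta_symm j i, W.eta_symm k i]
  rw [c3, c1, conductance]
  clear c3 c1
  generalize √(disc W u i j k) = s at *
  generalize disc W u i j k = D at *
  generalize edgeNum (W.eps i) (W.eps j) (W.eta i j) _ _ _ _ _ = A at *
  generalize edgeNum (W.eps i) (W.eps k) _ _ _ _ _ _ = B at *
  generalize edgeNum (W.eps j) (W.eps k) _ _ _ _ _ _ = C at *
  refine triangle_energy p3 p2 hd ?_ ?_ _ _ _
  · have : 2 * C / (lenSq W u j k * s) * (2 * B / (lenSq W u i k * s)) +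
        2 * B / (lenSq W u i k * s) * (2 * A / (lenSq W u i j * s)) +
        2 * A / (lenSq W u i j * s) * (2 * C / (lenSq W u j k * s)) =
        4 * (B * C * lenSq W u i j + A * C * lenSq W u i k + A * B * lenSq W u j k) /
          (lenSq W u i j * lenSq W u i k * lenSq W u j k * s ^ 2) := by
      field_simp
      ring
    rw [this, hmul]
    have : 0 < A + B + C := by linarith
    positivity
  · have : 2 * C / (lenSq W u j k * s) * lenSq W u j k +
        2 * B / (lenSq W u i k * s) * lenSq W u i k +
        2 * A / (lenSq W u i j * s) * lenSq W u i j = 2 * (A + B + C) / s := by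
      field_simp
      ring
    rw [this]
    have : 0 < A + B + C := by linarith
    positivity

end TriSurface

namespace TriSurface

variable {N : ℕ} {S : TriSurface N} (W : Weights S)

theorem exists_vertices {σ : Finset (Fin N)} (hσ : σ ∈ S.F) : ∃ i j k, σ = {i, j, k} := by
  obtain ⟨i, j, k, -, -, -, h⟩ := Finset.card_eq_three.mp (S.card_face σ hσ)
  exact ⟨i, j, k, h⟩

theorem faceAngleE_eq (u : Fin N → ℝ) {i j k : Fin N}
    (h : ({i, j, k} : Finset (Fin N)) ∈ S.F) : faceAngleE W u i {i, j, k} = thetaE W u i j k := by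
  classical
  obtain ⟨n1, n2, n3⟩ := face_ne h
  have e1 : ({i, j, k} : Finset (Fin N)).erase i = {j, k} := by
    ext x; simp; grind
  have e2 : ({j, k} : Finset (Fin N)).erase j = {k} := by
    ext x; simp; grind
  have e3 : ({j, k} : Finset (Fin N)).erase k = {j} := by
    ext x; simp; grind
  have key : (1 / 2 : ℝ) * ∑ a ∈ ({i, j, k} : Finset (Fin N)).erase i,
      ∑ b ∈ (({i, j, k} : Finset (Fin N)).erase i).erase a, thetaE W u i a b =
      thetaE W u i j k := by
    rw [e1, Finset.sum_pair n3, e2, e3, Finset.sum_singleton, Finset.sum_singleton,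
      thetaE_symm W u i k j]
    ring
  rw [← key, faceAngleE]

/-- The angles of a face, paired with a function on the vertices. -/
noncomputable def angleSum (y u : Fin N → ℝ) (σ : Finset (Fin N)) : ℝ :=
  ∑ i ∈ σ, y i * faceAngleE W u i σ

theorem angleSum_eq (y u : Fin N → ℝ) {i j k : Fin N}
    (h : ({i, j, k} : Finset (Fin N)) ∈ S.F) : angleSum W y u {i, j, k} =
      y i * thetaE W u i j k + y j * thetaE W u j k i + y k * thetaE W u k i j := by
  obtain ⟨n1, n2, n3⟩ := face_ne h
  rw [angleSum, Finset.sum_insert (by simp [n1, n2]), Finset.sum_pair n3, faceAngleE_eq W u h,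
    ← faceAngleE_eq W u (face_rot h), ← faceAngleE_eq W u (face_rot (face_rot h)), ← add_assoc]
  have e1 : ({j, k, i} : Finset (Fin N)) = {i, j, k} := by ext x; simp; tauto
  have e2 : ({k, i, j} : Finset (Fin N)) = {i, j, k} := by ext x; simp; tauto
  rw [e1, e2]

theorem sum_mul_KE (y u : Fin N → ℝ) :
    ∑ i, y i * KE W u i = 2 * π * ∑ i, y i - ∑ σ ∈ S.F, angleSum W y u σ := by
  classical
  have h : ∑ i, y i * ∑ σ ∈ S.F.filter (fun σ => i ∈ σ), faceAngleE W u i σ =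
      ∑ σ ∈ S.F, angleSum W y u σ := by
    simp only [Finset.mul_sum, Finset.sum_filter, angleSum]
    rw [Finset.sum_comm]
    refine Finset.sum_congr rfl fun σ _ => ?_
    simp
  rw [← h, Finset.mul_sum, ← Finset.sum_sub_distrib]
  refine Finset.sum_congr rfl fun i _ => ?_
  rw [KE, mul_sub, mul_comm (y i)]

theorem KE_eq_angleSum (u : Fin N → ℝ) (i : Fin N) :
    KE W u i = 2 * π - ∑ σ ∈ S.F, angleSum W (Pi.single i 1) u σ := by
  have h := sum_mul_KE W (Pi.single i 1) u
  simp only [Pi.single_apply, ite_mul, one_mul, zero_mul, Finset.sum_ite_eq',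
    Finset.mem_univ, if_true, mul_one] at h
  rw [h]

theorem continuous_angleSum (y : Fin N → ℝ) {σ : Finset (Fin N)} (hσ : σ ∈ S.F) :
    Continuous fun u => angleSum W y u σ := by
  obtain ⟨i, j, k, rfl⟩ := exists_vertices hσ
  simp only [angleSum_eq W y _ hσ]
  have h1 := continuous_thetaE W hσ
  have h2 := continuous_thetaE W (face_rot hσ)
  have h3 := continuous_thetaE W (face_rot (face_rot hσ))
  fun_prop

theorem contDiffAt_angleSum {n : ℕ∞} (y : Fin N → ℝ) {u : Fin N → ℝ} {i j k : Fin N}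
    (h : ({i, j, k} : Finset (Fin N)) ∈ S.F) (hD : 0 < disc W u i j k) :
    ContDiffAt ℝ n (fun u => angleSum W y u {i, j, k}) u := by
  simp only [angleSum_eq W y _ h]
  have h1 := contDiffAt_thetaE W (n := n) h hD
  have h2 := contDiffAt_thetaE W (n := n) (face_rot h) (by rwa [disc_rot])
  have h3 := contDiffAt_thetaE W (n := n) (face_rot (face_rot h)) (by rwa [disc_rot, disc_rot])
  fun_prop

theorem fderiv_angleSum (x y : Fin N → ℝ) {u : Fin N → ℝ} {i j k : Fin N}
    (h : ({i, j, k} : Finset (Fin N)) ∈ S.F) (hD : 0 < disc W u i j k) :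
    fderiv ℝ (fun u => angleSum W y u {i, j, k}) u x =
      -(conductance W u i j k * ((x i - x j) * (y i - y j)) +
        conductance W u i k j * ((x i - x k) * (y i - y k)) +
        conductance W u j k i * ((x j - x k) * (y j - y k))) := by
  have hD2 : 0 < disc W u j k i := by rwa [disc_rot]
  have hD3 : 0 < disc W u k i j := by rwa [disc_rot, disc_rot]
  have h1 := ((contDiffAt_thetaE W (n := 1) h hD).differentiableAt one_ne_zero).hasFDerivAt
  have h2 := ((contDiffAt_thetaE W (n := 1) (face_rot h) hD2).differentiableAt
    one_ne_zero).hasFDerivAt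
  have h3 := ((contDiffAt_thetaE W (n := 1) (face_rot (face_rot h)) hD3).differentiableAt
    one_ne_zero).hasFDerivAt
  have := ((h1.const_mul (y i)).fun_add (h2.const_mul (y j))).fun_add (h3.const_mul (y k))
  have e : (fun u => angleSum W y u {i, j, k}) = fun u =>
      y i * thetaE W u i j k + y j * thetaE W u j k i + y k * thetaE W u k i j := by
    funext u; exact angleSum_eq W y u h
  rw [e]
  rw [HasFDerivAt.fderiv this]
  simp only [add_apply, smul_apply, smul_eq_mul]
  rw [fderiv_thetaE W x h hD, fderiv_thetaE W x (face_rot h) hD2,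
    fderiv_thetaE W x (face_rot (face_rot h)) hD3, conductance_symm W u i j k,
    conductance_symm W u i k j, conductance_symm W u j k i]
  ring

/-- Along an affine line the angles of a face are monotone in the direction of the line, also
across degenerate triangles. -/
theorem antitone_angleSum (u v : Fin N → ℝ) {σ : Finset (Fin N)} (hσ : σ ∈ S.F) :
    Antitone fun t : ℝ => angleSum W v (u + t • v) σ := by
  have hc := continuous_angleSum W v hσ
  obtain ⟨i, j, k, rfl⟩ := exists_vertices hσ
  have hpair : ({0, π} : Set ℝ).Finite := by simp
  refine antitone_of_deriv_nonpos_off_finite_values (hc.comp (by fun_prop))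
    (((hpair.prod hpair).prod hpair).image fun s => v i * s.1.1 + v j * s.1.2 + v k * s.2)
    fun t ht => ?_
  have hD : 0 < disc W (u + t • v) i j k := by
    by_contra hD
    push Not at hD
    have z1 := thetaE_zero_or_pi W hσ hD
    have z2 := thetaE_zero_or_pi W (face_rot hσ) (by rwa [disc_rot])
    have z3 := thetaE_zero_or_pi W (face_rot (face_rot hσ)) (by rwa [disc_rot, disc_rot])
    refine ht ⟨((_, _), _), ⟨⟨z1, z2⟩, z3⟩, ?_⟩
    exact (angleSum_eq W v _ hσ).symm
  refine ⟨_, ?_, HasFDerivAt.comp_hasDerivAt_of_eq (x := t)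
    ((contDiffAt_angleSum W (n := 1) v hσ hD).differentiableAt one_ne_zero).hasFDerivAt
    (f := fun s : ℝ => u + s • v) (f' := v) ?_ rfl⟩
  · rw [fderiv_angleSum W v v hσ hD]
    have := (face_form_pos W v hσ hD).1
    linarith
  · simpa using ((hasDerivAt_id t).smul_const v).const_add u

theorem isOpen_admissibleE : IsOpen {u | admissibleE W u} := by
  simp only [admissibleE, Set.ofPred_forall]
  refine isOpen_iInter_of_finite fun i => isOpen_iInter_of_finite fun j =>
    isOpen_iInter_of_finite fun k => isOpen_iInter_of_finite fun _ => isOpen_lt ?_ ?_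
  · exact (continuous_lenSq W j k).sqrt
  · exact (continuous_lenSq W i j).sqrt.add (continuous_lenSq W i k).sqrt

theorem contDiffAt_angleSum_of_admissible {n : ℕ∞} (y : Fin N → ℝ) {u : Fin N → ℝ}
    (hu : admissibleE W u) {σ : Finset (Fin N)} (hσ : σ ∈ S.F) :
    ContDiffAt ℝ n (fun u => angleSum W y u σ) u := by
  obtain ⟨i, j, k, rfl⟩ := exists_vertices hσ
  exact contDiffAt_angleSum W y hσ (disc_pos_of_admissible W hu hσ)

theorem contDiffAt_KE {n : ℕ∞} {u : Fin N → ℝ} (hu : admissibleE W u) (i : Fin N) :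
    ContDiffAt ℝ n (fun u => KE W u i) u := by
  simp only [KE_eq_angleSum]
  exact contDiffAt_const.sub
    (ContDiffAt.sum fun σ hσ => contDiffAt_angleSum_of_admissible W _ hu hσ)

theorem sum_fderiv_KE {u : Fin N → ℝ} (hu : admissibleE W u) (x y : Fin N → ℝ) :
    ∑ i, y i * fderiv ℝ (fun u => KE W u i) u x =
      -∑ σ ∈ S.F, fderiv ℝ (fun u => angleSum W y u σ) u x := by
  have h1 : HasFDerivAt (fun u => ∑ i, y i * KE W u i)
      (∑ i, y i • fderiv ℝ (fun u => KE W u i) u) u :=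
    HasFDerivAt.fun_sum fun i _ =>
      (((contDiffAt_KE W (n := 1) hu i).differentiableAt one_ne_zero).hasFDerivAt).const_mul (y i)
  have h2 : HasFDerivAt (fun u => ∑ i, y i * KE W u i)
      (-∑ σ ∈ S.F, fderiv ℝ (fun u => angleSum W y u σ) u) u := by
    simp only [sum_mul_KE]
    exact (HasFDerivAt.fun_sum fun σ hσ => ((contDiffAt_angleSum_of_admissible W (n := 1) y hu
      hσ).differentiableAt one_ne_zero).hasFDerivAt).const_sub _
  have := congrArg (fun L => L x) (h1.unique h2)
  simpa using this

/-- The Jacobian of the curvature is symmetric. -/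
theorem sum_fderiv_KE_comm {u : Fin N → ℝ} (hu : admissibleE W u) (x y : Fin N → ℝ) :
    ∑ i, y i * fderiv ℝ (fun u => KE W u i) u x = ∑ i, x i * fderiv ℝ (fun u => KE W u i) u y := by
  rw [sum_fderiv_KE W hu, sum_fderiv_KE W hu]
  congr 1
  refine Finset.sum_congr rfl fun σ hσ => ?_
  obtain ⟨i, j, k, rfl⟩ := exists_vertices hσ
  have hD := disc_pos_of_admissible W hu hσ
  rw [fderiv_angleSum W x y hσ hD, fderiv_angleSum W y x hσ hD]
  ring

theorem sum_fderiv_KE_eq_zero {u : Fin N → ℝ} (hu : admissibleE W u) (x : Fin N → ℝ) :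
    ∑ i, fderiv ℝ (fun u => KE W u i) u x = 0 := by
  have h := sum_fderiv_KE W hu x 1
  simp only [Pi.one_apply, one_mul] at h
  rw [h, neg_eq_zero]
  refine Finset.sum_eq_zero fun σ hσ => ?_
  obtain ⟨i, j, k, rfl⟩ := exists_vertices hσ
  rw [fderiv_angleSum W x 1 hσ (disc_pos_of_admissible W hu hσ)]
  simp

theorem fderiv_KE_const {u : Fin N → ℝ} (hu : admissibleE W u) (c : ℝ) (i : Fin N) :
    fderiv ℝ (fun u => KE W u i) u (fun _ => c) = 0 := by
  have h := sum_fderiv_KE_comm W hu (fun _ => c) (Pi.single i 1)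
  rw [← Finset.mul_sum, sum_fderiv_KE_eq_zero W hu, mul_zero] at h
  simpa [Pi.single_apply] using h

theorem fderiv_angleSum_self_nonpos {u : Fin N → ℝ} (hu : admissibleE W u) (x : Fin N → ℝ)
    {σ : Finset (Fin N)} (hσ : σ ∈ S.F) :
    fderiv ℝ (fun u => angleSum W x u σ) u x ≤ 0 ∧
      (fderiv ℝ (fun u => angleSum W x u σ) u x = 0 → ∀ i ∈ σ, ∀ j ∈ σ, x i = x j) := by
  obtain ⟨i, j, k, rfl⟩ := exists_vertices hσ
  have hD := disc_pos_of_admissible W hu hσ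
  rw [fderiv_angleSum W x x hσ hD]
  obtain ⟨h1, h2⟩ := face_form_pos W x hσ hD
  simp only [← pow_two]
  refine ⟨by linarith, fun h => ?_⟩
  obtain ⟨h3, h4⟩ := h2 (by linarith)
  simp only [Finset.mem_insert, Finset.mem_singleton]
  rintro a ha b hb
  rcases ha with ha | ha | ha <;> rcases hb with hb | hb | hb <;> rw [ha, hb] <;> grind

theorem sum_fderiv_KE_self_nonneg {u : Fin N → ℝ} (hu : admissibleE W u) (x : Fin N → ℝ) :
    0 ≤ ∑ i, x i * fderiv ℝ (fun u => KE W u i) u x := by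
  rw [sum_fderiv_KE W hu, ← Finset.sum_neg_distrib]
  exact Finset.sum_nonneg fun σ hσ => neg_nonneg.mpr (fderiv_angleSum_self_nonpos W hu x hσ).1

/-- The kernel of the Jacobian of the curvature consists of the constant functions. -/
theorem eq_of_sum_fderiv_KE_self_eq_zero {u : Fin N → ℝ} (hu : admissibleE W u) {x : Fin N → ℝ}
    (h : ∑ i, x i * fderiv ℝ (fun u => KE W u i) u x = 0) (i j : Fin N) : x i = x j := by
  rw [sum_fderiv_KE W hu, ← Finset.sum_neg_distrib, Finset.sum_eq_zero_iff_of_nonneg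
    fun σ hσ => neg_nonneg.mpr (fderiv_angleSum_self_nonpos W hu x hσ).1] at h
  have hface : ∀ σ ∈ S.F, ∀ i ∈ σ, ∀ j ∈ σ, x i = x j := fun σ hσ =>
    (fderiv_angleSum_self_nonpos W hu x hσ).2 (neg_eq_zero.mp (h σ hσ))
  obtain ⟨p⟩ := S.connected.preconnected i j
  induction p with
  | nil => rfl
  | cons hadj _ ih =>
    rw [← ih]
    rw [SimpleGraph.fromRel_adj] at hadj
    obtain ⟨-, ⟨σ, hσ, ha, hb⟩ | ⟨σ, hσ, hb, ha⟩⟩ := hadj <;> exact hface σ hσ _ ha _ hb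

theorem sum_DKE (u x : Fin N → ℝ) (i : Fin N) :
    ∑ j, DKE W u i j * x j = fderiv ℝ (fun u => KE W u i) u x := by
  conv_rhs => rw [pi_eq_sum_univ' x, map_sum]
  refine Finset.sum_congr rfl fun j _ => ?_
  rw [map_smul, smul_eq_mul, mul_comm, DKE]

end TriSurface

namespace TriSurface

variable {N : ℕ} {S : TriSurface N} (W : Weights S)

theorem card_faces_mul_three (S : TriSurface N) : S.F.card * 3 = S.edges.card * 2 := by
  refine Finset.card_mul_eq_card_mul (fun σ e => e ⊆ σ) (fun σ hσ => ?_) fun e he => ?_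
  · have : S.edges.bipartiteAbove (fun σ e => e ⊆ σ) σ = Finset.powersetCard 2 σ := by
      ext e
      simp only [Finset.mem_bipartiteAbove, Finset.mem_powersetCard, edges, Finset.mem_biUnion]
      exact ⟨fun ⟨⟨_, _, _, h⟩, h'⟩ => ⟨h', h⟩, fun ⟨h, h'⟩ => ⟨⟨σ, hσ, h, h'⟩, h⟩⟩
    rw [this, Finset.card_powersetCard, S.card_face σ hσ]
    rfl
  · obtain ⟨σ, hσ, h⟩ := Finset.mem_biUnion.mp he
    rw [Finset.mem_powersetCard] at h
    exact S.edge_two_faces e h.2 ⟨σ, hσ, h.1⟩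

theorem angleSum_one {u : Fin N → ℝ} (hu : admissibleE W u) {σ : Finset (Fin N)} (hσ : σ ∈ S.F) :
    angleSum W 1 u σ = π := by
  obtain ⟨i, j, k, rfl⟩ := exists_vertices hσ
  obtain ⟨p1, p2, p3⟩ := lenSq_pos_face W u hσ
  have hD := disc_pos_of_admissible W hu hσ
  rw [angleSum_eq W _ _ hσ, ← arccos_sides_sum (sqrt_pos.mpr p1) (sqrt_pos.mpr p2)
    (sqrt_pos.mpr p3) (by rwa [sq_sqrt p1.le, sq_sqrt p2.le, sq_sqrt p3.le])]
  simp only [Pi.one_apply, one_mul, thetaE_eq]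
  rw [lenSq_symm W u j i, lenSq_symm W u k i, lenSq_symm W u k j]
  ring

/-- The discrete Gauss–Bonnet formula. -/
theorem sum_KE {u : Fin N → ℝ} (hu : admissibleE W u) : ∑ i, KE W u i = 2 * π * S.chi := by
  have h := sum_mul_KE W 1 u
  rw [Finset.sum_congr rfl fun σ hσ => angleSum_one W hu hσ] at h
  simp only [Pi.one_apply, one_mul, Finset.sum_const, Finset.card_univ, Fintype.card_fin,
    nsmul_eq_mul, mul_one] at h
  have hc : (S.F.card : ℝ) * 3 = S.edges.card * 2 := by exact_mod_cast card_faces_mul_three S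
  rw [h, chi]
  push_cast
  linear_combination -π * hc

theorem mul_exp_RE (α : ℝ) (u : Fin N → ℝ) (i : Fin N) :
    exp (α * u i) * RE W α u i = KE W u i := by
  rw [RE, mul_left_comm, ← exp_add]
  simp

theorem sum_exp_mul_RE (α : ℝ) {u : Fin N → ℝ} (hu : admissibleE W u) :
    ∑ i, exp (α * u i) * RE W α u i = 2 * π * S.chi := by
  simp only [mul_exp_RE, sum_KE W hu]

end TriSurface

/-- The density of the quantity `∑ i, e^{α u_i}` (resp. `∑ i, u_i` if `α = 0`) which is conserved
by the `α`-flows. -/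
noncomputable def conservedDensity (α x : ℝ) : ℝ := if α = 0 then x else exp (α * x)

theorem hasDerivAt_conservedDensity (α x : ℝ) :
    HasDerivAt (conservedDensity α) ((if α = 0 then 1 else α) * exp (α * x)) x := by
  by_cases hα : α = 0
  · have : conservedDensity α = id := by funext y; simp [conservedDensity, hα]
    rw [this]
    simpa [hα] using hasDerivAt_id x
  · have : conservedDensity α = fun y => exp (α * y) := by funext y; simp [conservedDensity, hα]
    rw [this]
    refine (((hasDerivAt_id x).const_mul α).exp).congr_deriv ?_
    simp [hα, mul_comm]

/-- The weighted squared distance to `ubar`. -/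
noncomputable def lyapunov {ι : Type*} [Fintype ι] (α : ℝ) (ubar u : ι → ℝ) : ℝ :=
  ∑ i, exp (α * ubar i) * (u i - ubar i) ^ 2

/-- A vector field which is Lipschitz near `ubar`, conserves the sum of `conservedDensity α`, and
contracts towards `ubar` along the level set of the conserved quantity. -/
structure IsContracting {ι : Type*} [Fintype ι] (α : ℝ) (ubar : ι → ℝ)
    (X : (ι → ℝ) → ι → ℝ) (r k : ℝ) : Prop where
  r_pos : 0 < r
  k_pos : 0 < k
  lipschitz : ∃ L, LipschitzOnWith L X (Metric.closedBall ubar r)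
  conserved : ∀ u ∈ Metric.closedBall ubar r, ∑ i, exp (α * u i) * X u i = 0
  decay : ∀ u ∈ Metric.closedBall ubar r,
    ∑ i, conservedDensity α (u i) = ∑ i, conservedDensity α (ubar i) →
    ∑ i, exp (α * ubar i) * (X u i * (u i - ubar i)) ≤ -k * lyapunov α ubar u

section

variable {ι : Type*} [Fintype ι] {α r k : ℝ} {ubar : ι → ℝ} {X : (ι → ℝ) → ι → ℝ}

theorem exists_lyapunov_lower_bound (α : ℝ) (ubar : ι → ℝ) :
    ∃ μ > 0, ∀ u : ι → ℝ, μ * ∑ i, (u i - ubar i) ^ 2 ≤ lyapunov α ubar u := by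
  have hμ : ∃ μ > 0, ∀ i, μ ≤ exp (α * ubar i) := by
    cases isEmpty_or_nonempty ι
    · exact ⟨1, one_pos, fun i => isEmptyElim i⟩
    · obtain ⟨i, hi⟩ := Finite.exists_min fun i => exp (α * ubar i)
      exact ⟨_, exp_pos _, hi⟩
  obtain ⟨μ, h0, hμ⟩ := hμ
  refine ⟨μ, h0, fun u => ?_⟩
  rw [Finset.mul_sum]
  exact Finset.sum_le_sum fun i _ => mul_le_mul_of_nonneg_right (hμ i) (sq_nonneg _)

theorem continuous_lyapunov (α : ℝ) (ubar : ι → ℝ) : Continuous (lyapunov α ubar) := by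
  unfold lyapunov; fun_prop

theorem lyapunov_self (α : ℝ) (ubar : ι → ℝ) : lyapunov α ubar ubar = 0 := by simp [lyapunov]

theorem exists_lyapunov_sublevel (α : ℝ) (ubar : ι → ℝ) (hr : 0 < r) :
    ∃ c > 0, ∀ u : ι → ℝ, lyapunov α ubar u ≤ c → u ∈ Metric.closedBall ubar r := by
  obtain ⟨μ, hμ, h⟩ := exists_lyapunov_lower_bound α ubar
  refine ⟨μ * r ^ 2, by positivity, fun u hu => ?_⟩
  rw [Metric.mem_closedBall, dist_pi_le_iff hr.le]
  intro i
  have h1 : (u i - ubar i) ^ 2 ≤ ∑ i, (u i - ubar i) ^ 2 :=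
    Finset.single_le_sum (f := fun i => (u i - ubar i) ^ 2) (fun i _ => sq_nonneg _)
      (Finset.mem_univ i)
  rw [Real.dist_eq]
  refine abs_le_of_sq_le_sq ?_ hr.le
  exact le_of_mul_le_mul_left ((mul_le_mul_of_nonneg_left h1 hμ.le).trans ((h u).trans hu)) hμ

/-- Trajectories of a contracting vector field starting near `ubar` stay near `ubar` and the
Lyapunov function decays exponentially along them. -/
theorem IsContracting.trapped (hX : IsContracting α ubar X r k) : ∃ ρ > 0,
    ∀ u : ℝ → ι → ℝ, dist (u 0) ubar < ρ →
      ∑ i, conservedDensity α (u 0 i) = ∑ i, conservedDensity α (ubar i) →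
      (∀ t ∈ Set.Ici (0 : ℝ), ∀ i, HasDerivWithinAt (fun s => u s i) (X (u t) i) (Set.Ici 0) t) →
      ∀ t, 0 ≤ t → u t ∈ Metric.closedBall ubar r ∧
        lyapunov α ubar (u t) ≤ lyapunov α ubar (u 0) * exp (-(2 * k) * t) := by
  obtain ⟨c, hc, hsub⟩ := exists_lyapunov_sublevel α ubar hX.r_pos
  have hnhds : ∀ᶠ u in nhds ubar, lyapunov α ubar u < c :=
    (continuous_lyapunov α ubar).continuousAt.eventually_lt continuousAt_const
      (by rwa [lyapunov_self])
  obtain ⟨ρ, hρ, hball⟩ := Metric.eventually_nhds_iff.mp hnhds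
  refine ⟨ρ, hρ, fun u h0 hcons hu => ?_⟩
  have hcont : ContinuousOn u (Set.Ici 0) :=
    continuousOn_pi.mpr fun i t ht => (hu t ht i).continuousWithinAt
  have hstep : ∀ T, 0 ≤ T → (∀ t ∈ Set.Icc 0 T, lyapunov α ubar (u t) ≤ c) →
      lyapunov α ubar (u T) ≤ lyapunov α ubar (u 0) * exp (-(2 * k) * T) := by
    intro T hT hle
    have hcon : ∀ t ∈ Set.Icc 0 T,
        ∑ i, conservedDensity α (u t i) = ∑ i, conservedDensity α (u 0 i) := by
      have hder : ∀ t ∈ Set.Icc 0 T,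
          HasDerivWithinAt (fun t => ∑ i, conservedDensity α (u t i)) 0 (Set.Ici 0) t := by
        intro t ht
        refine (HasDerivWithinAt.fun_sum fun i _ =>
          (hasDerivAt_conservedDensity α (u t i)).comp_hasDerivWithinAt t
            (hu t ht.1 i)).congr_deriv ?_
        have := hX.conserved _ (hsub _ (hle t ht))
        simp only [mul_assoc, ← Finset.mul_sum, this, mul_zero]
      exact constant_of_has_deriv_right_zero
        (fun t ht => (hder t ht).continuousWithinAt.mono Set.Icc_subset_Ici_self)
        fun t ht => (hder t (Set.Ico_subset_Icc_self ht)).mono (Set.Ici_subset_Ici.mpr ht.1)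
    refine le_mul_exp_of_deriv_le (V := fun t => lyapunov α ubar (u t))
      (V' := fun t => 2 * ∑ i, exp (α * ubar i) * (X (u t) i * (u t i - ubar i))) hT
      (fun t ht => ?_) fun t ht => ?_
    · refine (HasDerivWithinAt.fun_sum fun i _ =>
        (((hu t ht.1 i).sub_const (ubar i)).pow 2).const_mul (exp (α * ubar i))).congr_deriv ?_
      rw [Finset.mul_sum]
      refine Finset.sum_congr rfl fun i _ => ?_
      push_cast
      ring
    · have := hX.decay _ (hsub _ (hle t ht)) ((hcon t ht).trans hcons)
      linarith
  have hk := hX.k_pos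
  have hnn : 0 ≤ lyapunov α ubar (u 0) :=
    Finset.sum_nonneg fun i _ => mul_nonneg (exp_pos _).le (sq_nonneg _)
  have hall := le_of_bootstrap (V := fun t => lyapunov α ubar (u t))
    ((continuous_lyapunov α ubar).comp_continuousOn hcont) (hball h0) fun T hT hle =>
      (hstep T hT hle).trans (mul_le_of_le_one_right hnn
        (exp_le_one_iff.mpr (by nlinarith)))
  exact fun t ht => ⟨hsub _ (hall t ht), hstep t ht fun s hs => hall s hs.1⟩

/-- The nearest-point projection onto the sup-norm ball. -/
noncomputable def clampBall (ubar : ι → ℝ) (r : ℝ) (u : ι → ℝ) (i : ι) : ℝ :=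
  max (ubar i - r) (min (ubar i + r) (u i))

theorem lipschitzWith_clampBall (ubar : ι → ℝ) (r : ℝ) : LipschitzWith 1 (clampBall ubar r) := by
  refine LipschitzWith.of_dist_le_mul fun u v => ?_
  rw [dist_pi_le_iff (by positivity)]
  intro i
  exact (((LipschitzWith.eval (α := fun _ : ι => ℝ) i).const_min _).const_max _).dist_le_mul u v

theorem clampBall_mem (hr : 0 ≤ r) (ubar u : ι → ℝ) :
    clampBall ubar r u ∈ Metric.closedBall ubar r := by
  rw [Metric.mem_closedBall, dist_pi_le_iff hr]
  intro i
  rw [Real.dist_eq, abs_le, clampBall]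
  constructor
  · linarith [le_max_left (ubar i - r) (min (ubar i + r) (u i))]
  · have : max (ubar i - r) (min (ubar i + r) (u i)) ≤ ubar i + r :=
      max_le (by linarith) (min_le_left _ _)
    linarith

theorem clampBall_of_mem {u : ι → ℝ} (hu : u ∈ Metric.closedBall ubar r) :
    clampBall ubar r u = u := by
  funext i
  have h := (dist_le_pi_dist u ubar i).trans (Metric.mem_closedBall.mp hu)
  rw [Real.dist_eq, abs_le] at h
  rw [clampBall, min_eq_right (by linarith), max_eq_right (by linarith)]

/-- Near `ubar`, the flow of a contracting vector field exists for all time. -/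
theorem IsContracting.exists_solution (hX : IsContracting α ubar X r k) : ∃ ρ > 0,
    ∀ u₀ : ι → ℝ, dist u₀ ubar < ρ →
      ∑ i, conservedDensity α (u₀ i) = ∑ i, conservedDensity α (ubar i) →
      ∃ u : ℝ → ι → ℝ, u 0 = u₀ ∧ (∀ t, 0 ≤ t → u t ∈ Metric.closedBall ubar r) ∧
        ∀ t ∈ Set.Ici (0 : ℝ), ∀ i,
          HasDerivWithinAt (fun s => u s i) (X (u t) i) (Set.Ici 0) t := by
  have hr := hX.r_pos
  obtain ⟨L, hL⟩ := hX.lipschitz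
  set Y : (ι → ℝ) → ι → ℝ := fun u => X (clampBall ubar r u) with hYdef
  have hYX : ∀ u ∈ Metric.closedBall ubar r, Y u = X u := fun u hu => by
    simp only [hYdef, clampBall_of_mem hu]
  have hYL : LipschitzWith (L * 1) Y := by
    rw [← lipschitzOnWith_univ]
    exact hL.comp (lipschitzWith_clampBall ubar r).lipschitzOnWith
      fun u _ => clampBall_mem hr.le ubar u
  have hY : IsContracting α ubar Y r k :=
    { r_pos := hr
      k_pos := hX.k_pos
      lipschitz := ⟨_, hYL.lipschitzOnWith⟩
      conserved := fun u hu => by rw [hYX u hu]; exact hX.conserved u hu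
      decay := fun u hu => by rw [hYX u hu]; exact hX.decay u hu }
  have hbd : ∃ M : NNReal, ∀ u, ‖Y u‖ ≤ M := by
    refine ⟨‖X ubar‖₊ + L * ⟨r, hr.le⟩, fun u => ?_⟩
    have h1 := hL.dist_le_mul _ (clampBall_mem hr.le ubar u) _ (Metric.mem_closedBall_self hr.le)
    have h2 := mul_le_mul_of_nonneg_left (Metric.mem_closedBall.mp (clampBall_mem hr.le ubar u))
      L.coe_nonneg
    have h3 := norm_sub_norm_le (X (clampBall ubar r u)) (X ubar)
    rw [dist_eq_norm] at h1
    push_cast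
    change ‖X (clampBall ubar r u)‖ ≤ ‖X ubar‖ + L * r
    linarith
  obtain ⟨M, hM⟩ := hbd
  obtain ⟨ρ, hρ, htrap⟩ := hY.trapped
  refine ⟨ρ, hρ, fun u₀ h0 hcons => ?_⟩
  obtain ⟨u, hu0, hu⟩ := exists_forward_solution_of_lipschitz_of_bounded hYL hM u₀
  have hui : ∀ t ∈ Set.Ici (0 : ℝ), ∀ i,
      HasDerivWithinAt (fun s => u s i) (Y (u t) i) (Set.Ici 0) t :=
    fun t ht => hasDerivWithinAt_pi.mp (hu t ht)
  have hmem := fun t ht => (htrap u (by rwa [hu0]) (by rwa [hu0]) hui t ht).1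
  refine ⟨u, hu0, hmem, fun t ht i => ?_⟩
  rw [← hYX _ (hmem t ht)]
  exact hui t ht i

end

theorem IsContracting.expConvergesTo {N : ℕ} {α r k : ℝ} {ubar : Fin N → ℝ}
    {X : (Fin N → ℝ) → Fin N → ℝ} (hX : IsContracting α ubar X r k) : ∃ ρ > 0,
    ∀ u : ℝ → Fin N → ℝ, dist (u 0) ubar < ρ →
      ∑ i, conservedDensity α (u 0 i) = ∑ i, conservedDensity α (ubar i) →
      (∀ t ∈ Set.Ici (0 : ℝ), ∀ i, HasDerivWithinAt (fun s => u s i) (X (u t) i) (Set.Ici 0) t) →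
      ExpConvergesTo u ubar := by
  obtain ⟨ρ, hρ, htrap⟩ := hX.trapped
  obtain ⟨μ, hμ, hlow⟩ := exists_lyapunov_lower_bound α ubar
  refine ⟨ρ, hρ, fun u h0 hcons hu => ⟨√(lyapunov α ubar (u 0) / μ) + 1, by positivity, k,
    hX.k_pos, fun t ht => ?_⟩⟩
  have h1 := (hlow (u t)).trans (htrap u h0 hcons hu t ht).2
  have h2 : ∑ i, (u t i - ubar i) ^ 2 ≤
      lyapunov α ubar (u 0) / μ * exp (-k * t) ^ 2 := by
    rw [← exp_nat_mul, div_mul_eq_mul_div, le_div_iff₀ hμ, mul_comm]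
    convert h1 using 3
    push_cast
    ring
  calc TriSurface.enorm (fun i => u t i - ubar i) = √(∑ i, (u t i - ubar i) ^ 2) := rfl
    _ ≤ √(lyapunov α ubar (u 0) / μ * exp (-k * t) ^ 2) := sqrt_le_sqrt h2
    _ = √(lyapunov α ubar (u 0) / μ) * exp (-k * t) := by
      rw [sqrt_mul' _ (sq_nonneg _), sqrt_sq (exp_pos _).le]
    _ ≤ _ := by
      have := exp_pos (-k * t)
      nlinarith

theorem exists_nonpos_exists_nonneg_of_sum_eq {ι : Type*} [Fintype ι] [Nonempty ι] {α : ℝ}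
    {u v : ι → ℝ} (h : ∑ i, conservedDensity α (u i) = ∑ i, conservedDensity α (v i)) :
    (∃ i, (u - v) i ≤ 0) ∧ ∃ i, 0 ≤ (u - v) i := by
  have key : ∀ u v : ι → ℝ, ∑ i, conservedDensity α (u i) = ∑ i, conservedDensity α (v i) →
      ∃ i, u i ≤ v i := by
    intro u v h
    by_contra! hlt
    rcases lt_or_ge α 0 with hα | hα
    · refine (Finset.sum_lt_sum_of_nonempty Finset.univ_nonempty fun i _ => ?_).ne h
      simpa [conservedDensity, hα.ne] using mul_lt_mul_of_neg_left (hlt i) hα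
    · refine (Finset.sum_lt_sum_of_nonempty Finset.univ_nonempty fun i _ => ?_).ne' h
      rcases hα.eq_or_lt with hα | hα
      · simpa [conservedDensity, ← hα] using hlt i
      · simpa [conservedDensity, hα.ne'] using mul_lt_mul_of_pos_left (hlt i) hα
  obtain ⟨i, hi⟩ := key u v h
  obtain ⟨j, hj⟩ := key v u h.symm
  exact ⟨⟨i, sub_nonpos.mpr hi⟩, ⟨j, sub_nonneg.mpr hj⟩⟩

theorem sum_exp_eq_of_sum_conservedDensity_eq {ι : Type*} [Fintype ι] {α : ℝ} {u v : ι → ℝ}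
    (h : ∑ i, conservedDensity α (u i) = ∑ i, conservedDensity α (v i)) :
    ∑ i, exp (α * u i) = ∑ i, exp (α * v i) := by
  by_cases hα : α = 0
  · simp [hα]
  · simpa [conservedDensity, hα] using h

/-- A linear field which is negative definite on the cone of vectors with entries of both signs
dominates the nonlinear field it linearizes. -/
theorem exists_le_of_neg_on_cone {ι : Type*} [Fintype ι] {m : ι → ℝ} (hm : ∀ i, 0 < m i)
    {X : (ι → ℝ) → ι → ℝ} {L : (ι → ℝ) →L[ℝ] ι → ℝ} {ubar : ι → ℝ} (hX : HasFDerivAt X L ubar)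
    (h0 : X ubar = 0)
    (hneg : ∀ x : ι → ℝ, (∃ i, x i ≤ 0) → (∃ i, 0 ≤ x i) → x ≠ 0 → ∑ i, m i * (L x i * x i) < 0) :
    ∃ r > 0, ∃ k > 0, ∀ u ∈ Metric.closedBall ubar r, (∃ i, (u - ubar) i ≤ 0) →
      (∃ i, 0 ≤ (u - ubar) i) →
      ∑ i, m i * (X u i * (u i - ubar i)) ≤ -k * ∑ i, m i * (u i - ubar i) ^ 2 := by
  set C : Set (ι → ℝ) := {x | (∃ i, x i ≤ 0) ∧ ∃ i, 0 ≤ x i} with hC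
  have hCclosed : IsClosed C := by
    have e : C = (⋃ i, {x : ι → ℝ | x i ≤ 0}) ∩ ⋃ i, {x : ι → ℝ | 0 ≤ x i} := by
      ext x; simp [hC]
    rw [e]
    exact (isClosed_iUnion_of_finite fun i => isClosed_le (continuous_apply i)
      continuous_const).inter (isClosed_iUnion_of_finite fun i => isClosed_le continuous_const
      (continuous_apply i))
  have hq : Continuous fun x : ι → ℝ => ∑ i, m i * (L x i * x i) := by fun_prop
  have hlam : ∃ l > 0, ∀ x ∈ C, ∑ i, m i * (L x i * x i) ≤ -l * ‖x‖ ^ 2 := by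
    have hK : IsCompact (Metric.sphere (0 : ι → ℝ) 1 ∩ C) :=
      (isCompact_sphere 0 1).inter_right hCclosed
    have hl : ∃ l > 0, ∀ x ∈ Metric.sphere (0 : ι → ℝ) 1 ∩ C, ∑ i, m i * (L x i * x i) ≤ -l := by
      rcases (Metric.sphere (0 : ι → ℝ) 1 ∩ C).eq_empty_or_nonempty with he | hne
      · exact ⟨1, one_pos, by simp [he]⟩
      · obtain ⟨x, hx, hmax⟩ := hK.exists_isMaxOn hne hq.continuousOn
        have hx0 : x ≠ 0 := by
          rintro rfl
          simpa using hx.1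
        refine ⟨-∑ i, m i * (L x i * x i), neg_pos.mpr (hneg x hx.2.1 hx.2.2 hx0), fun y hy => ?_⟩
        rw [neg_neg]
        exact hmax hy
    obtain ⟨l, hl0, hl⟩ := hl
    refine ⟨l, hl0, fun x hx => ?_⟩
    rcases eq_or_ne x 0 with rfl | hx0
    · simp
    have hn : 0 < ‖x‖ := norm_pos_iff.mpr hx0
    have hmem : ‖x‖⁻¹ • x ∈ Metric.sphere (0 : ι → ℝ) 1 ∩ C := by
      refine ⟨by simp [norm_smul, hn.ne'], ?_, ?_⟩
      · obtain ⟨i, hi⟩ := hx.1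
        exact ⟨i, mul_nonpos_of_nonneg_of_nonpos (by positivity) hi⟩
      · obtain ⟨i, hi⟩ := hx.2
        exact ⟨i, mul_nonneg (by positivity) hi⟩
    have h1 := hl _ hmem
    have h2 : ∑ i, m i * (L (‖x‖⁻¹ • x) i * (‖x‖⁻¹ • x) i) =
        (‖x‖ ^ 2)⁻¹ * ∑ i, m i * (L x i * x i) := by
      rw [Finset.mul_sum]
      refine Finset.sum_congr rfl fun i _ => ?_
      rw [map_smul, Pi.smul_apply, Pi.smul_apply, smul_eq_mul, smul_eq_mul, ← inv_pow]
      ring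
    rw [h2, inv_mul_le_iff₀ (by positivity)] at h1
    linarith
  obtain ⟨l, hl0, hl⟩ := hlam
  set M := ∑ i, m i + 1 with hM
  have hMpos : 0 < M := by
    have := Finset.sum_nonneg fun i (_ : i ∈ Finset.univ) => (hm i).le
    linarith
  have hev := hX.isLittleO.def (c := l / (2 * M)) (by positivity)
  obtain ⟨r, hr, hball⟩ := Metric.nhds_basis_closedBall.mem_iff.mp hev
  refine ⟨r, hr, l / (2 * M), by positivity, fun u hu hu1 hu2 => ?_⟩
  have hest := hball hu
  simp only [Set.mem_ofPred_eq, h0, sub_zero] at hest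
  have hcone := hl (u - ubar) ⟨hu1, hu2⟩
  set v := u - ubar with hv
  have hvi : ∀ i, |v i| ≤ ‖v‖ := fun i => norm_le_pi_norm v i
  have hterm : ∀ i, m i * (X u i * v i) ≤ m i * (L v i * v i) + m i * (l / (2 * M) * ‖v‖ ^ 2) := by
    intro i
    rw [← mul_add]
    refine mul_le_mul_of_nonneg_left ?_ (hm i).le
    have h1 : |X u i - L v i| ≤ l / (2 * M) * ‖v‖ := (norm_le_pi_norm (X u - L v) i).trans hest
    have h2 : (X u i - L v i) * v i ≤ l / (2 * M) * ‖v‖ * ‖v‖ :=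
      (le_abs_self _).trans (by
        rw [abs_mul]
        exact mul_le_mul h1 (hvi i) (abs_nonneg _) (by positivity))
    linarith
  have hsq : ∑ i, m i * v i ^ 2 ≤ (∑ i, m i) * ‖v‖ ^ 2 := by
    rw [Finset.sum_mul]
    refine Finset.sum_le_sum fun i _ => mul_le_mul_of_nonneg_left ?_ (hm i).le
    exact sq_le_sq.mpr (by simpa using hvi i)
  have hsum := Finset.sum_le_sum fun i (_ : i ∈ Finset.univ) => hterm i
  rw [Finset.sum_add_distrib, ← Finset.sum_mul] at hsum
  change ∑ i, m i * (X u i * v i) ≤ -(l / (2 * M)) * ∑ i, m i * v i ^ 2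
  have e : l = 2 * (l / (2 * M)) * M := by field_simp
  have hpos : 0 < l / (2 * M) := by positivity
  generalize l / (2 * M) = b at *
  have e1 : (∑ i, m i) = M - 1 := by linarith
  rw [e1] at hsum hsq
  have : b * ∑ i, m i * v i ^ 2 ≤ b * ((M - 1) * ‖v‖ ^ 2) := mul_le_mul_of_nonneg_left hsq hpos.le
  have hv2 : 0 ≤ b * ‖v‖ ^ 2 := by positivity
  rw [e] at hcone
  linarith

theorem exists_isContracting {ι : Type*} [Fintype ι] [Nonempty ι] {α : ℝ} {ubar : ι → ℝ}
    {X Y : (ι → ℝ) → ι → ℝ} {L : (ι → ℝ) →L[ℝ] ι → ℝ} (hX : ContDiffAt ℝ 1 X ubar)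
    (hcons : ∀ᶠ u in nhds ubar, ∑ i, exp (α * u i) * X u i = 0)
    (hXY : ∀ᶠ u in nhds ubar,
      ∑ i, conservedDensity α (u i) = ∑ i, conservedDensity α (ubar i) → X u = Y u)
    (hY : HasFDerivAt Y L ubar) (hY0 : Y ubar = 0)
    (hneg : ∀ x : ι → ℝ, (∃ i, x i ≤ 0) → (∃ i, 0 ≤ x i) → x ≠ 0 →
      ∑ i, exp (α * ubar i) * (L x i * x i) < 0) {U : Set (ι → ℝ)} (hU : U ∈ nhds ubar) :
    ∃ r k, IsContracting α ubar X r k ∧ Metric.closedBall ubar r ⊆ U := by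
  obtain ⟨K, t, ht, hK⟩ := hX.exists_lipschitzOnWith
  obtain ⟨r, hr, k, hk, hdec⟩ :=
    exists_le_of_neg_on_cone (fun i => exp_pos (α * ubar i)) hY hY0 hneg
  have hev := (((Filter.eventually_mem_set.mpr ht).and hcons).and hXY).and
    ((Filter.eventually_mem_set.mpr hU).and
      (Filter.eventually_mem_set.mpr (Metric.closedBall_mem_nhds ubar hr)))
  obtain ⟨s, hs, hball⟩ := Metric.nhds_basis_closedBall.mem_iff.mp hev
  refine ⟨s, k, ⟨hs, hk, ⟨K, hK.mono fun u hu => (hball hu).1.1.1⟩,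
    fun u hu => (hball hu).1.1.2, fun u hu hc => ?_⟩, fun u hu => (hball hu).2.1⟩
  rw [(hball hu).1.2 hc]
  obtain ⟨h1, h2⟩ := exists_nonpos_exists_nonneg_of_sum_eq hc
  exact hdec u (hball hu).2.2 h1 h2

namespace TriSurface

variable {N : ℕ} {S : TriSurface N} (W : Weights S) {α c : ℝ} {ubar : Fin N → ℝ}

theorem nonempty_vertices (S : TriSurface N) : Nonempty (Fin N) := by
  obtain ⟨σ, hσ⟩ := S.F_nonempty
  have : σ.Nonempty := Finset.card_pos.mp (by rw [S.card_face σ hσ]; norm_num)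
  exact ⟨this.choose⟩

theorem sum_exp_pos (S : TriSurface N) (α : ℝ) (u : Fin N → ℝ) : 0 < ∑ i, exp (α * u i) :=
  have := nonempty_vertices S
  Finset.sum_pos (fun _ _ => exp_pos _) Finset.univ_nonempty

theorem mul_sum_exp_of_constant_RE (hbar : admissibleE W ubar) (hc : ∀ i, RE W α ubar i = c) :
    c * ∑ i, exp (α * ubar i) = 2 * π * S.chi := by
  rw [← sum_exp_mul_RE W α hbar, Finset.mul_sum]
  exact Finset.sum_congr rfl fun i _ => by rw [hc, mul_comm]

theorem mul_nonpos_of_constant_RE (hαχ : α * (S.chi : ℝ) ≤ 0) (hbar : admissibleE W ubar)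
    (hc : ∀ i, RE W α ubar i = c) : α * c ≤ 0 := by
  have h := mul_sum_exp_of_constant_RE W hbar hc
  have hs := sum_exp_pos S α ubar
  have h2 : α * c * ∑ i, exp (α * ubar i) ≤ 0 := by
    calc α * c * ∑ i, exp (α * ubar i) = 2 * π * (α * S.chi) := by rw [mul_assoc, h]; ring
      _ ≤ 0 := mul_nonpos_of_nonneg_of_nonpos (by positivity) hαχ
  exact nonpos_of_mul_nonpos_left h2 hs

theorem contDiffAt_RE {n : ℕ∞} {u : Fin N → ℝ} (hu : admissibleE W u) (i : Fin N) :
    ContDiffAt ℝ n (fun u => RE W α u i) u := by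
  have := contDiffAt_KE W (n := n) hu i
  unfold RE
  fun_prop

theorem fderiv_RE {u : Fin N → ℝ} (hu : admissibleE W u) (x : Fin N → ℝ) (i : Fin N) :
    fderiv ℝ (fun u => RE W α u i) u x =
      exp (-(α * u i)) * fderiv ℝ (fun u => KE W u i) u x - α * RE W α u i * x i := by
  have h1 := ((contDiffAt_KE W (n := 1) hu i).differentiableAt one_ne_zero).hasFDerivAt
  have h2 : HasFDerivAt (fun u : Fin N → ℝ => exp (-(α * u i))) _ u :=
    (((hasFDerivAt_apply (𝕜 := ℝ) i u).const_mul α).fun_neg).exp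
  have h3 := h1.fun_mul h2
  unfold RE
  rw [h3.fderiv]
  simp
  ring

theorem contDiffAt_DKE {u : Fin N → ℝ} (hu : admissibleE W u) (i j : Fin N) :
    ContDiffAt ℝ 1 (fun u => DKE W u i j) u := by
  unfold DKE
  exact ((contDiffAt_KE W (n := 2) hu i).fderiv_right (m := 1) (by norm_num)).clm_apply
    contDiffAt_const

theorem eventually_admissibleE {u : Fin N → ℝ} (hu : admissibleE W u) :
    ∀ᶠ v in nhds u, admissibleE W v :=
  (isOpen_admissibleE W).mem_nhds hu

theorem eq_zero_of_sum_fderiv_KE_self_eq_zero {u x : Fin N → ℝ} (hu : admissibleE W u)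
    (h1 : ∃ i, x i ≤ 0) (h2 : ∃ i, 0 ≤ x i)
    (h : ∑ i, x i * fderiv ℝ (fun u => KE W u i) u x = 0) : x = 0 := by
  obtain ⟨i, hi⟩ := h1
  obtain ⟨j, hj⟩ := h2
  have hx := eq_of_sum_fderiv_KE_self_eq_zero W hu h
  have : x i = 0 := le_antisymm hi (hx i j ▸ hj)
  funext k
  rw [hx k i, this, Pi.zero_apply]

/-- The vector field of the normalized Ricci flow. -/
noncomputable def ricciField (α : ℝ) (u : Fin N → ℝ) (i : Fin N) : ℝ :=
  2 * π * (S.chi : ℝ) / (∑ j, exp (α * u j)) - RE W α u i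

theorem isContracting_ricciField (hαχ : α * (S.chi : ℝ) ≤ 0) (hbar : admissibleE W ubar)
    (hc : ∀ i, RE W α ubar i = c) :
    ∃ r k, IsContracting α ubar (ricciField W α) r k ∧
      Metric.closedBall ubar r ⊆ {u | admissibleE W u} := by
  have := nonempty_vertices S
  have hαc := mul_nonpos_of_constant_RE W hαχ hbar hc
  have hchi := mul_sum_exp_of_constant_RE W hbar hc
  have hd : ∀ i,
      HasFDerivAt (fun u => c - RE W α u i) (-fderiv ℝ (fun u => RE W α u i) ubar) ubar :=
    fun i => (((contDiffAt_RE W (n := 1) hbar i).differentiableAt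
      one_ne_zero).hasFDerivAt).const_sub c
  refine exists_isContracting (Y := fun u i => c - RE W α u i) ?_ ?_ ?_ (hasFDerivAt_pi.mpr hd) ?_
    (fun x h1 h2 hx => ?_) (eventually_admissibleE W hbar)
  · refine contDiffAt_pi.mpr fun i => ?_
    have h1 := contDiffAt_RE W (α := α) (n := 1) hbar i
    refine ContDiffAt.sub (contDiffAt_const.div ?_ (sum_exp_pos S α ubar).ne') h1
    fun_prop
  · filter_upwards [eventually_admissibleE W hbar] with u hu
    simp only [ricciField, mul_sub, Finset.sum_sub_distrib, ← Finset.sum_mul]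
    rw [sum_exp_mul_RE W α hu, mul_div_cancel₀ _ (sum_exp_pos S α u).ne', sub_self]
  · refine Filter.Eventually.of_forall fun u hu => ?_
    funext i
    rw [ricciField, sum_exp_eq_of_sum_conservedDensity_eq hu, ← hchi,
      mul_div_cancel_right₀ _ (sum_exp_pos S α ubar).ne']
  · funext i
    simp [hc]
  · have hpos := (sum_fderiv_KE_self_nonneg W hbar x).lt_of_ne'
      fun h => hx (eq_zero_of_sum_fderiv_KE_self_eq_zero W hbar h1 h2 h)
    have hterm : ∀ i, exp (α * ubar i) * (-fderiv ℝ (fun u => RE W α u i) ubar x * x i) =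
        -(x i * fderiv ℝ (fun u => KE W u i) ubar x) +
          α * c * (exp (α * ubar i) * x i ^ 2) := by
      intro i
      rw [fderiv_RE W hbar, hc, exp_neg]
      field_simp
      ring
    have hnn : 0 ≤ ∑ i, exp (α * ubar i) * x i ^ 2 := Finset.sum_nonneg fun i _ => by positivity
    calc _ = ∑ i, exp (α * ubar i) * (-fderiv ℝ (fun u => RE W α u i) ubar x * x i) := rfl
      _ = -(∑ i, x i * fderiv ℝ (fun u => KE W u i) ubar x) +
          α * c * ∑ i, exp (α * ubar i) * x i ^ 2 := by
        simp only [hterm, Finset.sum_add_distrib, Finset.sum_neg_distrib, ← Finset.mul_sum]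
      _ < 0 := by nlinarith

/-- The vector field of the Calabi flow. -/
noncomputable def calabiField (α : ℝ) (u : Fin N → ℝ) (i : Fin N) : ℝ :=
  LapE W α u (RE W α u) i

theorem calabiField_eq {u : Fin N → ℝ} (hu : admissibleE W u) (c : ℝ) (i : Fin N) :
    calabiField W α u i = -exp (-(α * u i)) * ∑ j, DKE W u i j * (RE W α u j - c) := by
  simp only [calabiField, LapE, mul_sub, Finset.sum_sub_distrib]
  rw [sum_DKE W u (fun _ => c), fderiv_KE_const W hu, mul_zero, sub_zero]

theorem isContracting_calabiField (hαχ : α * (S.chi : ℝ) ≤ 0) (hbar : admissibleE W ubar)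
    (hc : ∀ i, RE W α ubar i = c) :
    ∃ r k, IsContracting α ubar (calabiField W α) r k ∧
      Metric.closedBall ubar r ⊆ {u | admissibleE W u} := by
  have := nonempty_vertices S
  have hαc := mul_nonpos_of_constant_RE W hαχ hbar hc
  have hsmooth : ContDiffAt ℝ 1 (calabiField W α) ubar := by
    refine contDiffAt_pi.mpr fun i => ?_
    have h1 := fun j => contDiffAt_RE W (α := α) (n := 1) hbar j
    have h2 := contDiffAt_DKE W hbar
    refine ContDiffAt.mul (by fun_prop) (ContDiffAt.sum fun j _ => (h2 i j).mul (h1 j))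
  have hd : ∀ i, HasFDerivAt (fun u => calabiField W α u i)
      (-exp (-(α * ubar i)) • ∑ j, DKE W ubar i j • fderiv ℝ (fun u => RE W α u j) ubar) ubar := by
    intro i
    have h1 := fun j => ((contDiffAt_RE W (α := α) (n := 1) hbar j).differentiableAt
      one_ne_zero).hasFDerivAt.sub_const c
    have h2 := fun j => ((contDiffAt_DKE W hbar i j).differentiableAt one_ne_zero).hasFDerivAt
    have h3 : HasFDerivAt (fun u => ∑ j, DKE W u i j * (RE W α u j - c))
        (∑ j, DKE W ubar i j • fderiv ℝ (fun u => RE W α u j) ubar) ubar := by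
      refine (HasFDerivAt.fun_sum fun j _ => (h2 j).fun_mul (h1 j)).congr_fderiv ?_
      simp [hc]
    have h4 : HasFDerivAt (fun u : Fin N → ℝ => -exp (-(α * u i))) _ ubar :=
      (((hasFDerivAt_apply (𝕜 := ℝ) i ubar).const_mul α).fun_neg).exp.fun_neg
    have h5 := h4.fun_mul h3
    refine (h5.congr_fderiv ?_).congr_of_eventuallyEq ?_
    · simp only [hc, sub_self, mul_zero, Finset.sum_const_zero, zero_smul, add_zero]
    · filter_upwards [eventually_admissibleE W hbar] with u hu
      exact calabiField_eq W hu c i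
  refine exists_isContracting (Y := calabiField W α) hsmooth ?_
    (Filter.Eventually.of_forall fun u _ => rfl) (hasFDerivAt_pi.mpr hd) ?_
    (fun x h1 h2 hx => ?_) (eventually_admissibleE W hbar)
  · filter_upwards [eventually_admissibleE W hbar] with u hu
    have : ∀ i, exp (α * u i) * calabiField W α u i =
        -fderiv ℝ (fun u => KE W u i) u (RE W α u) := by
      intro i
      rw [calabiField, LapE, sum_DKE, exp_neg]
      field_simp
    simp only [this, Finset.sum_neg_distrib, sum_fderiv_KE_eq_zero W hu, neg_zero]
  · funext i
    rw [calabiField_eq W hbar c]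
    simp [hc]
  · set y : Fin N → ℝ := fun j => fderiv ℝ (fun u => RE W α u j) ubar x with hy
    have hterm : ∀ i,
        exp (α * ubar i) * (-exp (-(α * ubar i)) * (∑ j, DKE W ubar i j * y j) * x i) =
        -(x i * fderiv ℝ (fun u => KE W u i) ubar y) := by
      intro i
      rw [sum_DKE, exp_neg]
      field_simp
    have hterm2 : ∀ i, y i * fderiv ℝ (fun u => KE W u i) ubar x =
        exp (-(α * ubar i)) * fderiv ℝ (fun u => KE W u i) ubar x ^ 2 -
          α * c * (x i * fderiv ℝ (fun u => KE W u i) ubar x) := by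
      intro i
      simp only [hy, fderiv_RE W hbar, hc]
      ring
    have hnn := sum_fderiv_KE_self_nonneg W hbar x
    have hpos : 0 < ∑ i, exp (-(α * ubar i)) * fderiv ℝ (fun u => KE W u i) ubar x ^ 2 := by
      refine (Finset.sum_nonneg fun i _ => by positivity).lt_of_ne' fun h => hx ?_
      rw [Finset.sum_eq_zero_iff_of_nonneg fun i _ => by positivity] at h
      refine eq_zero_of_sum_fderiv_KE_self_eq_zero W hbar h1 h2 (Finset.sum_eq_zero fun i hi => ?_)
      have := h i hi
      simp only [mul_eq_zero, (exp_pos _).ne', false_or, pow_eq_zero_iff two_ne_zero] at this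
      rw [this, mul_zero]
    calc _ = ∑ i, exp (α * ubar i) *
          (-exp (-(α * ubar i)) * (∑ j, DKE W ubar i j * y j) * x i) := by simp [hy]
      _ = -∑ i, y i * fderiv ℝ (fun u => KE W u i) ubar x := by
        simp only [hterm, Finset.sum_neg_distrib, sum_fderiv_KE_comm W hbar y x]
      _ = -(∑ i, exp (-(α * ubar i)) * fderiv ℝ (fun u => KE W u i) ubar x ^ 2) +
          α * c * ∑ i, x i * fderiv ℝ (fun u => KE W u i) ubar x := by
        simp only [hterm2, Finset.sum_sub_distrib, ← Finset.mul_sum]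
        ring
      _ < 0 := by nlinarith

end TriSurface

namespace TriSurface

variable {N : ℕ} {S : TriSurface N} (W : Weights S) {α c : ℝ} {ubar : Fin N → ℝ}

theorem abs_apply_le_enorm (v : Fin N → ℝ) (i : Fin N) : |v i| ≤ TriSurface.enorm v :=
  abs_le_sqrt (Finset.single_le_sum (f := fun i => v i ^ 2) (fun _ _ => sq_nonneg _)
    (Finset.mem_univ i))

theorem norm_le_enorm (v : Fin N → ℝ) : ‖v‖ ≤ TriSurface.enorm v :=
  (pi_norm_le_iff_of_nonneg (sqrt_nonneg _)).mpr (abs_apply_le_enorm v)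

/-- The defect `c e^{α u_i} - K_i` from constant curvature is monotone along affine lines. -/
theorem antitone_sum_mul_defect (hαc : α * c ≤ 0) (u v : Fin N → ℝ) :
    Antitone fun t : ℝ =>
      ∑ i, v i * (c * exp (α * (u + t • v) i) - KE W (u + t • v) i) := by
  have h1 : Antitone fun t : ℝ => ∑ σ ∈ S.F, angleSum W v (u + t • v) σ := fun s t hst =>
    Finset.sum_le_sum fun σ hσ => antitone_angleSum W u v hσ hst
  have h2 : Antitone fun t : ℝ => ∑ i, v i * (c * exp (α * (u + t • v) i)) := by
    refine fun s t hst => Finset.sum_le_sum fun i _ => ?_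
    refine antitone_of_hasDerivAt_nonpos (f := fun t : ℝ => v i * (c * exp (α * (u + t • v) i)))
      (f' := fun t => α * c * (exp (α * (u + t • v) i) * v i ^ 2)) (fun t => ?_) (fun t => ?_) hst
    · have h := (((((hasDerivAt_id t).mul_const (v i)).const_add (u i)).const_mul
        α).exp.const_mul c).const_mul (v i)
      refine h.congr_deriv ?_
      simp only [Pi.add_apply, Pi.smul_apply, smul_eq_mul, id]
      ring
    · exact mul_nonpos_of_nonpos_of_nonneg hαc (by positivity)
  intro s t hst
  have e : ∀ t : ℝ, ∑ i, v i * (c * exp (α * (u + t • v) i) - KE W (u + t • v) i) =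
      ∑ i, v i * (c * exp (α * (u + t • v) i)) + ∑ σ ∈ S.F, angleSum W v (u + t • v) σ -
        2 * π * ∑ i, v i := by
    intro t
    simp only [mul_sub, Finset.sum_sub_distrib]
    rw [sum_mul_KE]
    ring
  simp only [e]
  have := h1 hst
  have := h2 hst
  dsimp only at *
  linarith

/-- An admissible factor whose `α`-curvature is close to constant, with the normalization of
`ubar`, is close to `ubar`. -/
theorem dist_lt_of_enorm_RE_sub_lt (hα : α ≠ 0) (hαχ : α * (S.chi : ℝ) ≤ 0)
    (hbar : admissibleE W ubar) (hc : ∀ i, RE W α ubar i = c) {ρ : ℝ} (hρ : 0 < ρ) :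
    ∃ δ > 0, ∀ u : Fin N → ℝ,
      TriSurface.enorm (fun i => RE W α u i - RE W α ubar i) < δ →
      ∑ i, exp (α * u i) = ∑ i, exp (α * ubar i) → dist u ubar < ρ := by
  have := nonempty_vertices S
  have hαc := mul_nonpos_of_constant_RE W hαχ hbar hc
  have hd : ∀ i, HasFDerivAt (fun u : Fin N → ℝ => c * exp (α * u i) - KE W u i)
      (c • (exp (α * ubar i) •
        (α • ContinuousLinearMap.proj (R := ℝ) (φ := fun _ : Fin N => ℝ) i)) -
        fderiv ℝ (fun u => KE W u i) ubar) ubar := fun i =>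
    ((((hasFDerivAt_apply (𝕜 := ℝ) i ubar).const_mul α).exp).const_mul c).fun_sub
      ((contDiffAt_KE W (n := 1) hbar i).differentiableAt one_ne_zero).hasFDerivAt
  have hzero : ∀ i, c * exp (α * ubar i) - KE W ubar i = 0 := fun i => by
    rw [← mul_exp_RE W α ubar i, hc]
    ring
  obtain ⟨r, hr, k, hk, hdec⟩ := exists_le_of_neg_on_cone (m := fun _ => (1 : ℝ))
    (fun _ => one_pos) (X := fun u i => c * exp (α * u i) - KE W u i) (hasFDerivAt_pi.mpr hd)
    (funext hzero) fun x h1 h2 hx => by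
      have hpos := (sum_fderiv_KE_self_nonneg W hbar x).lt_of_ne'
        fun h => hx (eq_zero_of_sum_fderiv_KE_self_eq_zero W hbar h1 h2 h)
      have hnn : 0 ≤ ∑ i, exp (α * ubar i) * x i ^ 2 := Finset.sum_nonneg fun i _ => by positivity
      calc _ = ∑ i, (α * c * (exp (α * ubar i) * x i ^ 2) -
            x i * fderiv ℝ (fun u => KE W u i) ubar x) :=
            Finset.sum_congr rfl fun i _ => by
              simp
              ring
        _ = α * c * (∑ i, exp (α * ubar i) * x i ^ 2) -
            ∑ i, x i * fderiv ℝ (fun u => KE W u i) ubar x := by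
          rw [Finset.sum_sub_distrib, Finset.mul_sum]
        _ < 0 := by nlinarith
  set M := ∑ i, exp (α * ubar i) with hM
  have hMpos : 0 < M := sum_exp_pos S α ubar
  set p := min ρ r with hp
  have hp0 : 0 < p := lt_min hρ hr
  refine ⟨k * p / M, by positivity, fun u hu hnorm => ?_⟩
  refine lt_of_not_ge fun hge => ?_
  set v := u - ubar with hv
  set d := ‖v‖ with hdd
  have hpd : p ≤ d := (min_le_left _ _).trans (by rwa [dist_eq_norm] at hge)
  have hd0 : 0 < d := hp0.trans_le hpd
  obtain ⟨⟨i, hi⟩, ⟨j, hj⟩⟩ := exists_nonpos_exists_nonneg_of_sum_eq (α := α) (u := u) (v := ubar)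
    (by simpa [conservedDensity, hα] using hnorm)
  have hs0 : 0 < p / d := by positivity
  have hsub : ubar + (p / d) • v - ubar = (p / d) • v := by simp
  have hnear := hdec (ubar + (p / d) • v)
    (by
      rw [Metric.mem_closedBall, dist_eq_norm, hsub, norm_smul, norm_of_nonneg hs0.le,
        div_mul_cancel₀ _ hd0.ne']
      exact min_le_right _ _)
    ⟨i, by rw [hsub]; exact mul_nonpos_of_nonneg_of_nonpos hs0.le hi⟩
    ⟨j, by rw [hsub]; exact mul_nonneg hs0.le hj⟩
  have hsq : d ^ 2 ≤ ∑ i, v i ^ 2 := by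
    have h := norm_le_enorm v
    exact (pow_le_pow_left₀ hd0.le h 2).trans
      (sq_sqrt (Finset.sum_nonneg fun i _ => sq_nonneg (v i))).le
  set f : ℝ → ℝ := fun t => ∑ i, v i * (c * exp (α * (ubar + t • v) i) - KE W (ubar + t • v) i)
    with hf
  have hanti : f 1 ≤ f (p / d) :=
    antitone_sum_mul_defect W hαc ubar v (div_le_one_of_le₀ hpd hd0.le)
  have hfs : p / d * f (p / d) ≤ -k * ((p / d) ^ 2 * ∑ i, v i ^ 2) := by
    convert hnear using 1
    · rw [hf, Finset.mul_sum]
      refine Finset.sum_congr rfl fun i _ => ?_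
      simp only [Pi.add_apply, Pi.smul_apply, smul_eq_mul]
      ring
    · rw [Finset.mul_sum]
      congr 1
      refine Finset.sum_congr rfl fun i _ => ?_
      simp only [Pi.add_apply, Pi.smul_apply, smul_eq_mul]
      ring
  have hupper : f 1 ≤ -(k * p) * d := by
    have h1 : p / d * f (p / d) ≤ p / d * (-(k * p) * d) := by
      have h2 : (p / d) ^ 2 * d ^ 2 ≤ (p / d) ^ 2 * ∑ i, v i ^ 2 :=
        mul_le_mul_of_nonneg_left hsq (sq_nonneg _)
      have h3 : p / d * (-(k * p) * d) = -k * ((p / d) ^ 2 * d ^ 2) := by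
        field_simp
      rw [h3]
      exact hfs.trans (mul_le_mul_of_nonpos_left h2 (by linarith))
    exact hanti.trans (le_of_mul_le_mul_left h1 hs0)
  set ε := TriSurface.enorm (fun i => RE W α u i - RE W α ubar i) with hε
  have hlower : -(d * ε * M) ≤ f 1 := by
    have e : ubar + (1 : ℝ) • v = u := by simp [hv]
    rw [hf, ← hnorm]
    simp only [e, Finset.mul_sum, ← Finset.sum_neg_distrib]
    refine Finset.sum_le_sum fun i _ => ?_
    have h1 : |v i| ≤ d := norm_le_pi_norm v i
    have h2 : |RE W α u i - c| ≤ ε := by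
      have := abs_apply_le_enorm (fun i => RE W α u i - RE W α ubar i) i
      rwa [hc] at this
    have h3 : |v i * (RE W α u i - c)| ≤ d * ε := by
      rw [abs_mul]
      exact mul_le_mul h1 h2 (abs_nonneg _) hd0.le
    have h4 := mul_le_mul_of_nonneg_right (le_abs_self _ |>.trans h3) (exp_pos (α * u i)).le
    rw [← mul_exp_RE W α u i]
    linarith
  have hεM : ε * M < k * p := (lt_div_iff₀ hMpos).mp hu
  have := mul_lt_mul_of_pos_left hεM hd0
  linarith

end TriSurface

theorem IsContracting.exists_flow {N : ℕ} {α r k : ℝ} {ubar : Fin N → ℝ}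
    {X : (Fin N → ℝ) → Fin N → ℝ} (hX : IsContracting α ubar X r k) {U : (Fin N → ℝ) → Prop}
    (hU : Metric.closedBall ubar r ⊆ {u | U u}) : ∃ ρ > 0, ∀ u₀ : Fin N → ℝ, dist u₀ ubar < ρ →
      ∑ i, conservedDensity α (u₀ i) = ∑ i, conservedDensity α (ubar i) →
      (∃ u : ℝ → Fin N → ℝ, u 0 = u₀ ∧ ((∀ t ∈ Set.Ici (0 : ℝ), U (u t)) ∧
        ∀ t ∈ Set.Ici (0 : ℝ), ∀ i,
          HasDerivWithinAt (fun s => u s i) (X (u t) i) (Set.Ici 0) t) ∧ ExpConvergesTo u ubar) ∧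
      ∀ u : ℝ → Fin N → ℝ, u 0 = u₀ → ((∀ t ∈ Set.Ici (0 : ℝ), U (u t)) ∧
        ∀ t ∈ Set.Ici (0 : ℝ), ∀ i,
          HasDerivWithinAt (fun s => u s i) (X (u t) i) (Set.Ici 0) t) → ExpConvergesTo u ubar := by
  obtain ⟨ρ₁, h₁, hconv⟩ := hX.expConvergesTo
  obtain ⟨ρ₂, h₂, hex⟩ := hX.exists_solution
  refine ⟨min ρ₁ ρ₂, lt_min h₁ h₂, fun u₀ h0 hcons => ⟨?_, ?_⟩⟩
  · obtain ⟨u, hu0, hmem, hu⟩ := hex u₀ (h0.trans_le (min_le_right _ _)) hcons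
    refine ⟨u, hu0, ⟨fun t ht => hU (hmem t ht), hu⟩, hconv u ?_ ?_ hu⟩
    · rw [hu0]
      exact h0.trans_le (min_le_left _ _)
    · rwa [hu0]
  · rintro u rfl ⟨-, hu⟩
    exact hconv u (h0.trans_le (min_le_left _ _)) hcons hu

/-- local stability of the Euclidean `α`-flows.  Let `αχ ≤ 0` and let
`ū ∈ U^E` have constant combinatorial `α`-curvature.  Then there is `δ > 0` such that for
every admissible initial value `u(0)` with `‖R_α(u(0)) − R_α(ū)‖ < δ` and
`Σ e^{α u_i(0)} = Σ e^{α ū_i}` (when `α ≠ 0`), resp. `‖u(0) − ū‖ < δ` and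
`Σ u_i(0) = Σ ū_i` (when `α = 0`), the combinatorial `α`-Calabi flow and the normalized
combinatorial `α`-Ricci flow admit global solutions starting from `u(0)`, and every such
global solution converges exponentially fast to `ū`. -/
theorem euclidean_flows_local_convergence {N : ℕ} (S : TriSurface N)
    (W : TriSurface.Weights S) (α : ℝ) (hαχ : α * (S.chi : ℝ) ≤ 0)
    (ubar : Fin N → ℝ) (hbar : admissibleE W ubar)
    (hconst : ∃ c : ℝ, ∀ i, RE W α ubar i = c) :
    ∃ δ > (0 : ℝ), ∀ u0 : Fin N → ℝ, admissibleE W u0 →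
      (α ≠ 0 → TriSurface.enorm (fun i => RE W α u0 i - RE W α ubar i) < δ ∧
        ∑ i, Real.exp (α * u0 i) = ∑ i, Real.exp (α * ubar i)) →
      (α = 0 → TriSurface.enorm (fun i => u0 i - ubar i) < δ ∧
        ∑ i, u0 i = ∑ i, ubar i) →
      ((∃ u : ℝ → Fin N → ℝ, u 0 = u0 ∧ IsCalabiSolE W α u ∧ ExpConvergesTo u ubar) ∧
       (∀ u : ℝ → Fin N → ℝ, u 0 = u0 → IsCalabiSolE W α u → ExpConvergesTo u ubar)) ∧
      ((∃ u : ℝ → Fin N → ℝ, u 0 = u0 ∧ IsNormRicciSolE W α u ∧ ExpConvergesTo u ubar) ∧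
       (∀ u : ℝ → Fin N → ℝ, u 0 = u0 → IsNormRicciSolE W α u → ExpConvergesTo u ubar)) := by
  obtain ⟨c, hc⟩ := hconst
  obtain ⟨_, _, hC, hCU⟩ := isContracting_calabiField W hαχ hbar hc
  obtain ⟨_, _, hR, hRU⟩ := isContracting_ricciField W hαχ hbar hc
  obtain ⟨ρ₁, h₁, hcalabi⟩ := hC.exists_flow hCU
  obtain ⟨ρ₂, h₂, hricci⟩ := hR.exists_flow hRU
  have hflows : ∀ u0, dist u0 ubar < min ρ₁ ρ₂ →
      ∑ i, conservedDensity α (u0 i) = ∑ i, conservedDensity α (ubar i) → _ ∧ _ :=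
    fun u0 h hcons => ⟨hcalabi u0 (h.trans_le (min_le_left _ _)) hcons,
      hricci u0 (h.trans_le (min_le_right _ _)) hcons⟩
  by_cases hα : α = 0
  · refine ⟨min ρ₁ ρ₂, lt_min h₁ h₂, fun u0 _ _ h => hflows u0 ?_ ?_⟩
    · rw [dist_eq_norm]
      exact (norm_le_enorm _).trans_lt (h hα).1
    · simpa [conservedDensity, hα] using (h hα).2
  · obtain ⟨δ, hδ, hdist⟩ := dist_lt_of_enorm_RE_sub_lt W hα hαχ hbar hc (lt_min h₁ h₂)
    refine ⟨δ, hδ, fun u0 _ h _ => hflows u0 (hdist u0 (h hα).1 (h hα).2) ?_⟩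
    simpa [conservedDensity, hα] using (h hα).2
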